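/- Let Ω₁ ⊆ Ω₂ ⊂ ℝ² be nonempty bounded convex open sets and let k ≥ 1. Then μ_k(Ω₁) ≥ (π²/(2j_{0,1} + (k−1)π)²)·μ_k(Ω₂), where j_{0,1} is the first positive zero of the Bessel function J₀; in particular α_{k,2} ≥ π²/(2j_{0,1} + (k−1)π)². -/

import Mathlib

open MeasureTheory Real Filter

noncomputable section

/-- Euclidean space `ℝ^d`. -/
abbrev Euc (d : ℕ) := EuclideanSpace ℝ (Fin d)

/-- The Rayleigh quotient of a function `u` on a set `Ω ⊆ ℝ^d`. -/
noncomputable def rayleigh {d : ℕ} (Ω : Set (Euc d)) (u : Euc d → ℝ) : ℝ :=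
  (∫ x in Ω, ‖fderiv ℝ u x‖ ^ 2) / (∫ x in Ω, (u x) ^ 2)

/-- The `k`-th Neumann eigenvalue of `Ω ⊆ ℝ^d`, defined by the variational (min-max)
principle: the infimum, over all subspaces `V` of smooth functions `ℝ^d → ℝ` whose space of
restrictions to `Ω` is `(k+1)`-dimensional, of the supremum of the Rayleigh quotient over
the elements of `V` that are nonzero in `L²(Ω)`. -/
noncomputable def neumannEigenvalue {d : ℕ} (k : ℕ) (Ω : Set (Euc d)) : ℝ :=
  sInf { t : ℝ | ∃ V : Submodule ℝ (Euc d → ℝ),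
    (∀ u ∈ V, ContDiff ℝ (⊤ : ℕ∞) u) ∧
    Module.finrank ℝ (V.map (LinearMap.funLeft ℝ ℝ ((↑) : Ω → Euc d))) = k + 1 ∧
    t = sSup { r : ℝ | ∃ u ∈ V, (0 < ∫ x in Ω, (u x) ^ 2) ∧ r = rayleigh Ω u } }

/-- A nonempty bounded convex open subset of `ℝ^d`. -/
def IsConvexDomain {d : ℕ} (Ω : Set (Euc d)) : Prop :=
  Ω.Nonempty ∧ IsOpen Ω ∧ Bornology.IsBounded Ω ∧ Convex ℝ Ω

/-- The optimal constant `α_{k,d}`: the infimum of `μ_k(Ω₁)/μ_k(Ω₂)` over all pairs of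
nonempty bounded convex open sets `Ω₁ ⊆ Ω₂ ⊂ ℝ^d`. -/
noncomputable def alphaConst (k d : ℕ) : ℝ :=
  sInf { r : ℝ | ∃ Ω₁ Ω₂ : Set (Euc d), IsConvexDomain Ω₁ ∧ IsConvexDomain Ω₂ ∧ Ω₁ ⊆ Ω₂ ∧
    r = neumannEigenvalue k Ω₁ / neumannEigenvalue k Ω₂ }

/-- The Bessel function of the first kind of order `ν` (for `x > 0`). -/
noncomputable def besselJ (ν : ℝ) (x : ℝ) : ℝ :=
  ∑' m : ℕ, ((-1 : ℝ) ^ m / (m.factorial * Real.Gamma (m + ν + 1))) * (x / 2) ^ (2 * (m : ℝ) + ν)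

/-- The first positive zero `j_{ν,1}` of the Bessel function `J_ν`. -/
noncomputable def besselZero1 (ν : ℝ) : ℝ :=
  sInf {x : ℝ | 0 < x ∧ besselJ ν x = 0}

/-- The second positive zero `j_{ν,2}` of the Bessel function `J_ν`. -/
noncomputable def besselZero2 (ν : ℝ) : ℝ :=
  sInf {x : ℝ | besselZero1 ν < x ∧ besselJ ν x = 0}

open Topology

open MeasureTheory Real Filter

/-- Auxiliary entire functions: `J_n(x) = (x/2)^n B_n(x^2/4)`. -/
def bB (n : ℕ) (z : ℝ) : ℝ := ∑' m : ℕ, ((-1 : ℝ) ^ m / (m.factorial * (m + n).factorial)) * z ^ m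

lemma bB_coeff_abs (n m : ℕ) : |((-1 : ℝ) ^ m / (m.factorial * (m + n).factorial))| ≤ 1 / m.factorial := by
  rw [abs_div, abs_pow, abs_neg, abs_one, one_pow]
  have h1 : (1:ℝ) ≤ (m+n).factorial := by exact_mod_cast Nat.one_le_iff_ne_zero.2 (Nat.factorial_ne_zero _)
  have h2 : (0:ℝ) < m.factorial := by exact_mod_cast Nat.factorial_pos _
  rw [abs_of_pos (by positivity)]
  apply one_div_le_one_div_of_le h2
  nlinarith

lemma bB_summable (n : ℕ) (z : ℝ) :
    Summable fun m : ℕ => ((-1 : ℝ) ^ m / (m.factorial * (m + n).factorial)) * z ^ m := by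
  refine Summable.of_norm_bounded (Real.summable_pow_div_factorial |z|) (fun m => ?_)
  rw [Real.norm_eq_abs, abs_mul, abs_pow]
  calc _ ≤ 1 / (m.factorial : ℝ) * |z| ^ m := by gcongr; exact bB_coeff_abs n m
    _ = _ := by ring

lemma bB_hasDerivAt (n : ℕ) (z : ℝ) : HasDerivAt (bB n) (-(bB (n+1) z)) z := by
  set R := |z| + 1 with hR
  have hR0 : 0 < R := by positivity
  have key := hasDerivAt_tsum_of_isPreconnected
    (g := fun m y => ((-1 : ℝ) ^ m / (m.factorial * (m + n).factorial)) * y ^ m)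
    (g' := fun m y => ((-1 : ℝ) ^ m / (m.factorial * (m + n).factorial)) * (m * y ^ (m-1)))
    (u := fun m : ℕ => R ^ (m-1) / (m-1).factorial) (t := Set.Ioo (-R) R) (y₀ := 0) (y := z)
    ?_ isOpen_Ioo isPreconnected_Ioo ?_ ?_ ?_ (bB_summable n 0) ?_
  · refine key.congr_deriv ?_
    unfold bB
    have hs : Summable fun m : ℕ => ((-1 : ℝ) ^ m / (m.factorial * (m + n).factorial)) * (m * z ^ (m-1)) := by
      rw [← summable_nat_add_iff 1]
      refine (bB_summable (n+1) z).neg.congr (fun m => ?_)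
      simp only [Nat.add_sub_cancel, Nat.factorial_succ, pow_succ]
      have : m + 1 + n = m + (n+1) := by ring
      rw [this]
      push_cast
      field_simp
    rw [hs.tsum_eq_zero_add, ← tsum_neg]
    simp only [Nat.cast_zero, zero_mul, mul_zero, zero_add]
    congr 1
    ext m
    simp only [Nat.add_sub_cancel, Nat.factorial_succ, pow_succ]
    have : m + 1 + n = m + (n+1) := by ring
    rw [this]
    push_cast
    field_simp
  · rw [← summable_nat_add_iff 1]
    simpa using Real.summable_pow_div_factorial R
  · intro m y _
    simpa using (hasDerivAt_pow m y).const_mul _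
  · intro m y hy
    have hy' : |y| ≤ R := (abs_lt.2 hy).le
    rw [Real.norm_eq_abs, abs_mul, abs_mul, abs_pow, Nat.abs_cast]
    rcases m with _ | m
    · simp
    · calc _ ≤ 1 / ((m+1).factorial : ℝ) * (((m+1 : ℕ) : ℝ) * R ^ (m + 1 - 1)) := by
            gcongr; exact bB_coeff_abs n _
        _ = _ := by
            simp only [Nat.add_sub_cancel, Nat.factorial_succ]
            push_cast
            field_simp
  · constructor <;> linarith
  · exact ⟨by have := neg_abs_le z; linarith, by have := le_abs_self z; linarith⟩

lemma bB_contDiff (n : ℕ) : ContDiff ℝ (⊤ : ℕ∞) (bB n) := by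
  have : ∀ k : ℕ, ∀ n : ℕ, ContDiff ℝ k (bB n) := by
    intro k
    induction k with
    | zero => intro n; exact contDiff_zero.2 (continuous_iff_continuousAt.2 fun z => (bB_hasDerivAt n z).continuousAt)
    | succ k ih =>
      intro n
      have : ((k + 1 : ℕ) : WithTop ℕ∞) = (k : WithTop ℕ∞) + 1 := by push_cast; rfl
      rw [this, contDiff_succ_iff_deriv]
      refine ⟨fun z => (bB_hasDerivAt n z).differentiableAt, by simp, ?_⟩
      have h : deriv (bB n) = fun z => -(bB (n+1) z) := by
        ext z; exact (bB_hasDerivAt n z).deriv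
      rw [h]
      exact (ih (n+1)).neg
  exact contDiff_infty.2 fun k => this k n

lemma bB_rec (z : ℝ) : bB 0 z = bB 1 z - z * bB 2 z := by
  have h0 := (bB_summable 0 z).hasSum
  have h1 := (bB_summable 1 z).hasSum
  have h2 := (bB_summable 2 z).hasSum.mul_left z
  have h2' : HasSum (fun m : ℕ => if m = 0 then 0 else
     z * (((-1 : ℝ) ^ (m-1) / ((m-1).factorial * (m - 1 + 2).factorial)) * z ^ (m-1))) (z * bB 2 z) := by
    rw [← hasSum_nat_add_iff' 1]
    simpa [bB] using h2
  refine h0.unique ?_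
  refine (h1.sub h2').congr_fun (fun m => ?_)
  rcases m with _ | m
  · simp
  · simp only [Nat.add_sub_cancel, Nat.succ_ne_zero, if_false, add_eq_zero, one_ne_zero, and_false, add_zero]
    have e1 : m + 1 + 1 = m + 2 := rfl
    simp only [e1, Nat.factorial_succ, pow_succ]
    push_cast
    field_simp
    ring

/-- The Bessel function `J_0` as a smooth even function on `ℝ`. -/
def J0 (x : ℝ) : ℝ := bB 0 (x ^ 2 / 4)
/-- derivative of J0 -/
def J0' (x : ℝ) : ℝ := -(x / 2) * bB 1 (x ^ 2 / 4)

lemma J0_eq (x : ℝ) (hx : 0 < x) : besselJ 0 x = J0 x := by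
  unfold besselJ J0 bB
  congr 1
  ext m
  have h1 : Real.Gamma ((m:ℝ) + 0 + 1) = m.factorial := by rw [add_zero]; exact Real.Gamma_nat_eq_factorial m
  rw [h1]
  have h2 : (x/2) ^ (2 * (m:ℝ) + 0) = (x^2/4)^m := by
    rw [add_zero]
    have : (2 * (m:ℝ)) = ((2*m : ℕ) : ℝ) := by push_cast; rfl
    rw [this, Real.rpow_natCast, pow_mul]
    congr 1; ring
  rw [h2, add_zero]

lemma J0_contDiff : ContDiff ℝ (⊤ : ℕ∞) J0 := by
  unfold J0
  exact (bB_contDiff 0).comp (by fun_prop)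

lemma J0_hasDerivAt (x : ℝ) : HasDerivAt J0 (J0' x) x := by
  have h : HasDerivAt (fun x : ℝ => x^2/4) (x/2) x := by
    have := (hasDerivAt_pow 2 x).div_const 4
    refine this.congr_deriv ?_; simp; ring
  have := (bB_hasDerivAt 0 (x^2/4)).comp x h
  unfold J0 J0'
  refine this.congr_deriv ?_
  simp; ring

lemma J0'_hasDerivAt (x : ℝ) : HasDerivAt (fun x => x * J0' x) (-(x * J0 x)) x := by
  have h : HasDerivAt (fun x : ℝ => x^2/4) (x/2) x := by
    have := (hasDerivAt_pow 2 x).div_const 4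
    refine this.congr_deriv ?_; simp; ring
  have h1 := (bB_hasDerivAt 1 (x^2/4)).comp x h
  have h2 : HasDerivAt (fun x : ℝ => -(x^2/2)) (-x) x := by
    have := ((hasDerivAt_pow 2 x).div_const 2).neg
    refine this.congr_deriv ?_; simp; try ring
  have := h2.mul h1
  unfold J0' J0
  rw [bB_rec]
  have e : (fun x : ℝ => x * (-(x / 2) * bB 1 (x ^ 2 / 4))) =
      ((fun x => -(x ^ 2 / 2)) * bB 1 ∘ fun x => x ^ 2 / 4) := by
    ext y; simp [Function.comp]; ring
  rw [e]
  refine this.congr_deriv ?_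
  simp [Function.comp]; ring

lemma J0_zero : J0 0 = 1 := by
  unfold J0 bB
  rw [tsum_eq_single 0]
  · simp
  · intro m hm; simp [hm]

lemma J0'_continuous : Continuous J0' := by
  unfold J0'
  have := (bB_contDiff 1).continuous
  fun_prop

/-- sign of the derivative of J0 where J0 is nonnegative -/
lemma J0'_nonpos {a : ℝ} (h : ∀ x ∈ Set.Icc 0 a, 0 ≤ J0 x) : ∀ x ∈ Set.Icc 0 a, J0' x ≤ 0 := by
  intro x hx
  have hanti : AntitoneOn (fun x => x * J0' x) (Set.Icc 0 a) := by
    apply antitoneOn_of_deriv_nonpos (convex_Icc 0 a)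
    · exact (continuous_id.mul J0'_continuous).continuousOn
    · intro y _; exact (J0'_hasDerivAt y).differentiableAt.differentiableWithinAt
    · intro y hy
      rw [interior_Icc] at hy
      rw [(J0'_hasDerivAt y).deriv]
      have := h y ⟨hy.1.le, hy.2.le⟩
      have := hy.1
      simp; positivity
  rcases hx.1.eq_or_lt with h0 | h0
  · rw [← h0]; simp [J0']
  · have := hanti ⟨le_refl 0, hx.1.trans hx.2⟩ hx hx.1
    simp at this
    by_contra hc
    push Not at hc
    nlinarith [mul_pos h0 hc]

lemma J0_exists_zero : ∃ x, 0 < x ∧ J0 x = 0 := by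
  by_contra hcon
  push Not at hcon
  have hc : Continuous J0 := J0_contDiff.continuous
  have hpos : ∀ x, 0 ≤ x → 0 < J0 x := by
    intro x hx
    by_contra hle
    push Not at hle
    have := intermediate_value_Icc' hx hc.continuousOn
    obtain ⟨y, hy, hy0⟩ := this ⟨hle, by rw [J0_zero]; exact zero_le_one⟩
    rcases hy.1.eq_or_lt with h0 | h0
    · rw [← h0, J0_zero] at hy0; norm_num at hy0
    · exact hcon y h0 hy0
  have hanti : StrictAntiOn (fun x => x * J0' x) (Set.Ici 0) := by
    apply strictAntiOn_of_deriv_neg (convex_Ici 0)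
    · exact (continuous_id.mul J0'_continuous).continuousOn
    · intro y hy
      rw [interior_Ici] at hy
      rw [(J0'_hasDerivAt y).deriv]
      have := hpos y (le_of_lt hy)
      have : (0:ℝ) < y := hy
      simp; positivity
  have h1 : J0' 1 < 0 := by
    have := hanti (Set.mem_Ici.2 le_rfl) (Set.mem_Ici.2 zero_le_one) zero_lt_one
    simpa using this
  set c := -J0' 1 with hcdef
  have hanti2 : AntitoneOn (fun x => J0 x + c * Real.log x) (Set.Ici 1) := by
    apply antitoneOn_of_deriv_nonpos (convex_Ici 1)
    · apply ContinuousOn.add hc.continuousOn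
      apply ContinuousOn.mul continuousOn_const
      apply Real.continuousOn_log.mono
      intro x hx; simp at hx ⊢; linarith
    · intro y hy
      rw [interior_Ici] at hy
      have : (1:ℝ) < y := hy
      exact ((J0_hasDerivAt y).add ((Real.hasDerivAt_log (by linarith)).const_mul c)).differentiableAt.differentiableWithinAt
    · intro y hy
      rw [interior_Ici] at hy
      have hy1 : (1:ℝ) < y := hy
      rw [HasDerivAt.deriv (f := fun x => J0 x + c * Real.log x) ((J0_hasDerivAt y).add ((Real.hasDerivAt_log (by linarith : y ≠ 0)).const_mul c))]
      have h2 := hanti (Set.mem_Ici.2 zero_le_one) (Set.mem_Ici.2 (by linarith)) hy1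
      simp at h2
      have : y * (J0' y + c * y⁻¹) < 0 := by
        have : y * (J0' y + c * y⁻¹) = y * J0' y + c := by field_simp
        rw [this]; linarith
      by_contra hh
      push Not at hh
      nlinarith [mul_pos (by linarith : 0 < y) hh]
  have hcpos : 0 < c := by linarith
  have := hanti2 (Set.mem_Ici.2 le_rfl) (Set.mem_Ici.2 (Real.one_le_exp (x := J0 1 / c) (div_nonneg (hpos 1 zero_le_one).le hcpos.le))) (Real.one_le_exp (div_nonneg (hpos 1 zero_le_one).le hcpos.le))
  simp only [Real.log_exp, Real.log_one] at this
  have h3 := hpos (Real.exp (J0 1 / c)) (Real.exp_pos _).le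
  have h4 : c * (J0 1 / c) = J0 1 := by field_simp
  linarith

lemma bz_set : {x : ℝ | 0 < x ∧ besselJ 0 x = 0} = {x : ℝ | 0 ≤ x ∧ J0 x = 0} := by
  ext x
  simp only [Set.mem_ofPred_eq]
  constructor
  · rintro ⟨h1, h2⟩; exact ⟨h1.le, by rw [← J0_eq x h1]; exact h2⟩
  · rintro ⟨h1, h2⟩
    have : 0 < x := by
      rcases h1.eq_or_lt with h | h
      · rw [← h, J0_zero] at h2; norm_num at h2
      · exact h
    exact ⟨this, by rw [J0_eq x this]; exact h2⟩

lemma bz_mem : 0 < besselZero1 0 ∧ J0 (besselZero1 0) = 0 := by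
  have hcl : IsClosed {x : ℝ | 0 ≤ x ∧ J0 x = 0} :=
    (isClosed_Ici).inter (isClosed_eq J0_contDiff.continuous continuous_const)
  have hne : {x : ℝ | 0 ≤ x ∧ J0 x = 0}.Nonempty := by
    obtain ⟨x, hx, hx0⟩ := J0_exists_zero; exact ⟨x, hx.le, hx0⟩
  have := hcl.csInf_mem hne ⟨0, fun x hx => hx.1⟩
  rw [← bz_set] at this
  have h2 := this.1
  refine ⟨h2, ?_⟩
  rw [bz_set] at this
  unfold besselZero1
  rw [bz_set]
  exact this.2

lemma J0_pos_of_lt {x : ℝ} (hx : 0 ≤ x) (hx1 : x < besselZero1 0) : 0 < J0 x := by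
  by_contra hle
  push Not at hle
  obtain ⟨y, hy, hy0⟩ := intermediate_value_Icc' hx J0_contDiff.continuous.continuousOn ⟨hle, by rw [J0_zero]; exact zero_le_one⟩
  have : besselZero1 0 ≤ y := by
    unfold besselZero1
    rw [bz_set]
    exact csInf_le ⟨0, fun x hx => hx.1⟩ ⟨hy.1, hy0⟩
  linarith [hy.2]

open MeasureTheory Real Filter

lemma lower_piece {a s : ℝ} (ha : 0 ≤ a) {g : ℝ → ℝ} (hg : AntitoneOn g (Set.Ioo 0 a)) :
    ∃ r ∈ Set.Icc 0 a, {x | x ∈ Set.Ioo 0 a ∧ s < g x} =ᵐ[volume] Set.Ioc 0 r := by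
  set S := {x | x ∈ Set.Ioo 0 a ∧ s < g x} with hS
  by_cases hne : S.Nonempty
  · have hb : BddAbove S := ⟨a, fun x hx => hx.1.2.le⟩
    refine ⟨sSup S, ⟨?_, ?_⟩, ?_⟩
    · obtain ⟨x, hx⟩ := hne
      exact hx.1.1.le.trans (le_csSup hb hx)
    · exact csSup_le hne (fun x hx => hx.1.2.le)
    · have h1 : S ≤ᵐ[volume] Set.Ioc 0 (sSup S) :=
        Eventually.of_forall fun x hx => ⟨hx.1.1, le_csSup hb hx⟩
      have h2 : Set.Ioo 0 (sSup S) ≤ᵐ[volume] S := by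
        refine Eventually.of_forall fun x hx => ?_
        obtain ⟨y, hy, hxy⟩ := exists_lt_of_lt_csSup hne hx.2
        have hxm : x ∈ Set.Ioo 0 a := ⟨hx.1, hxy.trans hy.1.2⟩
        exact ⟨hxm, hy.2.trans_le (hg hxm hy.1 hxy.le)⟩
      exact h1.antisymm (Ioo_ae_eq_Ioc.symm.le.trans h2)
  · refine ⟨0, ⟨le_rfl, ha⟩, ?_⟩
    rw [Set.not_nonempty_iff_eq_empty.1 hne]
    simp

lemma integral_mul_antitone_nonneg {a : ℝ} (ha : 0 ≤ a) {p g : ℝ → ℝ} (hp : Continuous p)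
    (hP : ∀ r ∈ Set.Icc 0 a, 0 ≤ ∫ x in (0:ℝ)..r, p x)
    (hg : AntitoneOn g (Set.Ioo 0 a)) (hg0 : ∀ x ∈ Set.Ioo 0 a, 0 ≤ g x)
    (hi : IntegrableOn (fun x => p x * g x) (Set.Ioo 0 a)) :
    0 ≤ ∫ x in Set.Ioo 0 a, p x * g x := by
  have hgm : AEMeasurable g (volume.restrict (Set.Ioo 0 a)) :=
    aemeasurable_restrict_of_antitoneOn measurableSet_Ioo hg
  set G := hgm.mk g with hG
  have hGm : Measurable G := hgm.measurable_mk
  have hGg : ∀ᵐ x ∂(volume.restrict (Set.Ioo 0 a)), g x = G x := hgm.ae_eq_mk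
  have hG0 : ∀ᵐ x ∂(volume.restrict (Set.Ioo 0 a)), 0 ≤ G x := by
    filter_upwards [hGg, ae_restrict_mem measurableSet_Ioo] with x hx hx2
    rw [← hx]; exact hg0 x hx2
  let T : Set (ℝ × ℝ) := {z | z.2 < G z.1}
  have hT : MeasurableSet T := measurableSet_lt measurable_snd (hGm.comp measurable_fst)
  let K : ℝ × ℝ → ℝ := fun z => T.indicator (fun z => p z.1) z
  have hKm : Measurable K := (hp.measurable.comp measurable_fst).indicator hT
  have hsec : ∀ x, ∀ c : ℝ, (fun s => T.indicator (fun _ => c) (x, s)) = (Set.Iio (G x)).indicator (fun _ => c) := by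
    intro x c; ext s
    simp only [Set.indicator, T, Set.mem_ofPred_eq, Set.mem_Iio]
  have hKsec : ∀ x s, K (x, s) = (Set.Iio (G x)).indicator (fun _ => p x) s := by
    intro x s
    simp only [K, Set.indicator, T, Set.mem_ofPred_eq, Set.mem_Iio]
  have hint1 : ∀ c : ℝ, ∀ x, 0 ≤ G x → ∫ s in Set.Ioi 0, (Set.Iio (G x)).indicator (fun _ => c) s = c * G x := by
    intro c x hx
    rw [integral_indicator measurableSet_Iio, Measure.restrict_restrict measurableSet_Iio,
      Set.Iio_inter_Ioi]
    simp [hx, mul_comm]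
  have hKint : Integrable K ((volume.restrict (Set.Ioo 0 a)).prod (volume.restrict (Set.Ioi 0))) := by
    rw [integrable_prod_iff hKm.aestronglyMeasurable]
    constructor
    · refine Eventually.of_forall fun x => ?_
      simp only [hKsec]
      rw [integrable_indicator_iff measurableSet_Iio, IntegrableOn,
        Measure.restrict_restrict measurableSet_Iio, Set.Iio_inter_Ioi]
      exact integrableOn_const (by simp) 
    · refine hi.norm.congr ?_
      filter_upwards [hG0, hGg] with x hx hx2
      simp only [hKsec, norm_indicator_eq_indicator_norm]
      rw [hint1 _ _ hx, hx2, norm_mul, Real.norm_of_nonneg hx]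
  have h1 : ∫ x in Set.Ioo 0 a, p x * g x = ∫ x in Set.Ioo 0 a, ∫ s in Set.Ioi 0, K (x, s) := by
    refine integral_congr_ae ?_
    filter_upwards [hG0, hGg] with x hx hx2
    simp only [hKsec]
    rw [hint1 _ _ hx, hx2]
  rw [h1, integral_integral_swap (f := fun x s => K (x, s)) hKint]
  refine integral_nonneg fun s => ?_
  obtain ⟨r, hr, hr2⟩ := lower_piece (s := s) ha hg
  have h2 : ∫ x in Set.Ioo 0 a, K (x, s) = ∫ x in Set.Ioc 0 r, p x := by
    rw [← setIntegral_congr_set hr2]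
    have h3 : {x | x ∈ Set.Ioo 0 a ∧ s < g x} =ᵐ[volume] {x | x ∈ Set.Ioo 0 a ∧ s < G x} := by
      rw [ae_restrict_iff' measurableSet_Ioo] at hGg
      filter_upwards [hGg] with x hx
      apply propext
      constructor
      · rintro ⟨h, h'⟩; exact ⟨h, by rw [← hx h]; exact h'⟩
      · rintro ⟨h, h'⟩; exact ⟨h, by rw [hx h]; exact h'⟩
    rw [setIntegral_congr_set h3]
    have h4 : {x | x ∈ Set.Ioo 0 a ∧ s < G x} = {x | s < G x} ∩ Set.Ioo 0 a := by
      ext x; exact and_comm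
    have hm : MeasurableSet {x | s < G x} := measurableSet_lt measurable_const hGm
    rw [h4, ← Measure.restrict_restrict hm, ← integral_indicator hm]
    rfl
  show 0 ≤ ∫ x in Set.Ioo 0 a, K (x, s)
  rw [h2, ← intervalIntegral.integral_of_le hr.1]
  exact hP r hr

/-- End-piece inequality. -/
lemma end_piece {κ : ℝ} (hκ : 0 < κ) {h : ℝ → ℝ}
    (hi : IntegrableOn h (Set.Ioo 0 (besselZero1 0 / κ)))
    (h0 : ∀ x ∈ Set.Ioo 0 (besselZero1 0 / κ), 0 ≤ h x)
    (hanti : AntitoneOn (fun x => h x / x) (Set.Ioo 0 (besselZero1 0 / κ))) :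
    ∫ x in Set.Ioo 0 (besselZero1 0 / κ), (κ * J0' (κ * x)) ^ 2 * h x ≤
      κ ^ 2 * ∫ x in Set.Ioo 0 (besselZero1 0 / κ), (J0 (κ * x)) ^ 2 * h x := by
  set a := besselZero1 0 / κ with ha
  have hj := bz_mem
  have hapos : 0 < a := div_pos hj.1 hκ
  have hκa : κ * a = besselZero1 0 := by rw [ha]; field_simp
  have hcJ : Continuous J0 := J0_contDiff.continuous
  have hcJ' := J0'_continuous
  let p : ℝ → ℝ := fun x => x * (κ ^ 2 * (J0 (κ * x)) ^ 2 - (κ * J0' (κ * x)) ^ 2)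
  have hp : Continuous p := by fun_prop
  have hbdd : ∀ q : ℝ → ℝ, Continuous q → IntegrableOn (fun x => q x * h x) (Set.Ioo 0 a) := by
    intro q hq
    obtain ⟨C, hC⟩ := (isCompact_Icc (a := (0:ℝ)) (b := a)).exists_bound_of_continuousOn hq.continuousOn
    refine Integrable.bdd_mul (c := C) hi hq.aestronglyMeasurable ?_
    filter_upwards [ae_restrict_mem measurableSet_Ioo] with x hx
    exact hC x ⟨hx.1.le, hx.2.le⟩
  have hprim : ∀ x, HasDerivAt (fun x => -(κ * x * J0' (κ * x) * J0 (κ * x))) (p x) x := by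
    intro x
    have hl : HasDerivAt (fun x : ℝ => κ * x) κ x := by
      simpa using (hasDerivAt_id x).const_mul κ
    have h1 := (J0'_hasDerivAt (κ * x)).comp x hl
    have h2 := (J0_hasDerivAt (κ * x)).comp x hl
    refine (h1.mul h2).neg.congr_deriv ?_
    simp only [Function.comp, p]
    ring
  have hJnn : ∀ x ∈ Set.Icc 0 (besselZero1 0), 0 ≤ J0 x := by
    intro x hx
    rcases hx.2.eq_or_lt with h | h
    · rw [h, hj.2]
    · exact (J0_pos_of_lt hx.1 h).le
  have key := integral_mul_antitone_nonneg (a := a) hapos.le (p := p) (g := fun x => h x / x) hp ?_ hanti ?_ ?_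
  · have e : ∫ x in Set.Ioo 0 a, p x * (h x / x) =
        ∫ x in Set.Ioo 0 a, (κ ^ 2 * ((J0 (κ * x)) ^ 2 * h x) - (κ * J0' (κ * x)) ^ 2 * h x) := by
      refine setIntegral_congr_fun measurableSet_Ioo fun x hx => ?_
      have : x ≠ 0 := hx.1.ne'
      simp only [p]
      field_simp
    rw [e, integral_sub, integral_const_mul] at key
    · linarith
    · exact (hbdd _ (by fun_prop)).const_mul _
    · exact hbdd _ (by fun_prop)
  · intro r hr
    rw [intervalIntegral.integral_eq_sub_of_hasDerivAt (fun x _ => hprim x) (hp.intervalIntegrable _ _)]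
    have hr' : κ * r ∈ Set.Icc 0 (besselZero1 0) := ⟨mul_nonneg hκ.le hr.1, by rw [← hκa]; gcongr; exact hr.2⟩
    have := J0'_nonpos hJnn _ hr'
    have h2 := hJnn _ hr'
    have h3 := hr'.1
    have : 0 ≤ κ * r * (-J0' (κ * r)) * J0 (κ * r) := by
      have : 0 ≤ -J0' (κ * r) := by linarith
      positivity
    simp
    linarith
  · intro x hx; exact div_nonneg (h0 x hx) hx.1.le
  · refine (hbdd (fun x => κ ^ 2 * (J0 (κ * x)) ^ 2 - (κ * J0' (κ * x)) ^ 2) (by fun_prop)).congr_fun ?_ measurableSet_Ioo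
    intro x hx
    have : x ≠ 0 := hx.1.ne'
    simp only [p]
    field_simp

lemma concave_fold {h : ℝ → ℝ} {m c : ℝ} (hc : ConcaveOn ℝ (Set.Ioo (m - c) (m + c)) h) :
    AntitoneOn (fun t => h (m + t) + h (m - t)) (Set.Ioo 0 c) := by
  intro s hs t ht hst
  have ht0 : 0 < t := ht.1
  have m1 : m + t ∈ Set.Ioo (m - c) (m + c) := ⟨by linarith [ht.1, ht.2], by linarith [ht.2]⟩
  have m2 : m - t ∈ Set.Ioo (m - c) (m + c) := ⟨by linarith [ht.1, ht.2], by linarith [ht.1, ht.2]⟩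
  have hw1 : 0 ≤ (t + s) / (2 * t) := by have := hs.1; positivity
  have hw2 : 0 ≤ (t - s) / (2 * t) := div_nonneg (by linarith) (by positivity)
  have hw : (t + s) / (2 * t) + (t - s) / (2 * t) = 1 := by field_simp; ring
  have a1 := hc.2 m1 m2 hw1 hw2 hw
  have a2 := hc.2 m1 m2 hw2 hw1 (by rw [add_comm]; exact hw)
  simp only [smul_eq_mul] at a1 a2
  have e1 : (t + s) / (2 * t) * (m + t) + (t - s) / (2 * t) * (m - t) = m + s := by field_simp; ring
  have e2 : (t - s) / (2 * t) * (m + t) + (t + s) / (2 * t) * (m - t) = m - s := by field_simp; ring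
  rw [e1] at a1
  rw [e2] at a2
  show h (m + t) + h (m - t) ≤ h (m + s) + h (m - s)
  have e3 : (t - s) / (2 * t) = 1 - (t + s) / (2 * t) := by linarith
  rw [e3] at a1 a2
  linarith

/-- Middle-piece inequality. -/
lemma mid_piece {κ : ℝ} (hκ : 0 < κ) {h : ℝ → ℝ} {m : ℝ}
    (hi : IntegrableOn h (Set.Ioo (m - π / (2 * κ)) (m + π / (2 * κ))))
    (h0 : ∀ x ∈ Set.Ioo (m - π / (2 * κ)) (m + π / (2 * κ)), 0 ≤ h x)
    (hc : ConcaveOn ℝ (Set.Ioo (m - π / (2 * κ)) (m + π / (2 * κ))) h) :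
    ∫ x in Set.Ioo (m - π / (2 * κ)) (m + π / (2 * κ)), (κ * -Real.sin (κ * (x - m))) ^ 2 * h x ≤
      κ ^ 2 * ∫ x in Set.Ioo (m - π / (2 * κ)) (m + π / (2 * κ)), (Real.cos (κ * (x - m))) ^ 2 * h x := by
  set c := π / (2 * κ) with hcdef
  have hcpos : 0 < c := by positivity
  let p : ℝ → ℝ := fun x => κ ^ 2 * Real.cos (2 * κ * x)
  have hp : Continuous p := by fun_prop
  have hbdd : ∀ q : ℝ → ℝ, Continuous q → IntegrableOn (fun x => q x * h x) (Set.Ioo (m - c) (m + c)) := by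
    intro q hq
    obtain ⟨C, hC⟩ := (isCompact_Icc (a := m - c) (b := m + c)).exists_bound_of_continuousOn hq.continuousOn
    refine Integrable.bdd_mul (c := C) hi hq.aestronglyMeasurable ?_
    filter_upwards [ae_restrict_mem measurableSet_Ioo] with x hx
    exact hC x ⟨hx.1.le, hx.2.le⟩
  have hII : IntervalIntegrable (fun x => p (x - m) * h x) volume (m - c) (m + c) := by
    rw [intervalIntegrable_iff_integrableOn_Ioo_of_le (by linarith)]
    exact hbdd (fun x => p (x - m)) (by fun_prop)
  have hII2 : IntervalIntegrable (fun t => p t * h (m + t)) volume (-c) c := by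
    have := hII.comp_add_left m
    simpa using this
  have hsub1 : Set.uIcc (0:ℝ) c ⊆ Set.uIcc (-c) c := by
    rw [Set.uIcc_of_le hcpos.le, Set.uIcc_of_le (by linarith)]
    exact Set.Icc_subset_Icc (by linarith) le_rfl
  have hsub2 : Set.uIcc (-c) (0:ℝ) ⊆ Set.uIcc (-c) c := by
    rw [Set.uIcc_of_le (by linarith : -c ≤ 0), Set.uIcc_of_le (by linarith : -c ≤ c)]
    exact Set.Icc_subset_Icc le_rfl (by linarith)
  have i1 : IntervalIntegrable (fun t => p t * h (m + t)) volume 0 c := hII2.mono_set hsub1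
  have i2' : IntervalIntegrable (fun t => p t * h (m + t)) volume (-c) 0 := hII2.mono_set hsub2
  have hpeven : ∀ t, p (-t) = p t := by intro t; simp [p]
  have i2 : IntervalIntegrable (fun t => p t * h (m - t)) volume 0 c := by
    have := (i2'.comp_mul_left (c := -1))
    have h2 := this.symm
    norm_num at h2
    simpa [hpeven, sub_eq_add_neg] using h2
  have split : ∫ t in (-c)..c, p t * h (m + t) = ∫ t in (0:ℝ)..c, p t * (h (m + t) + h (m - t)) := by
    rw [← intervalIntegral.integral_add_adjacent_intervals i2' i1]
    have : ∫ t in (-c)..0, p t * h (m + t) = ∫ t in (0:ℝ)..c, p t * h (m - t) := by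
      have := intervalIntegral.integral_comp_neg (a := 0) (b := c) (fun t => p t * h (m + t))
      rw [neg_zero] at this
      rw [← this]
      simp [hpeven, sub_eq_add_neg]
    rw [this, ← intervalIntegral.integral_add i2 i1]
    congr 1
    ext t; ring
  have key := integral_mul_antitone_nonneg (a := c) hcpos.le (p := p) hp ?_ (concave_fold hc) ?_ ?_
  · rw [← integral_Ioc_eq_integral_Ioo, ← intervalIntegral.integral_of_le hcpos.le, ← split] at key
    have e : ∫ t in (-c)..c, p t * h (m + t) = ∫ x in (m-c)..(m+c), p (x - m) * h x := by
      have := intervalIntegral.integral_comp_add_left (a := -c) (b := c) (fun x => p (x - m) * h x) m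
      simp only [add_sub_cancel_left] at this
      rw [this, ← sub_eq_add_neg]
    rw [e, intervalIntegral.integral_of_le (by linarith), integral_Ioc_eq_integral_Ioo] at key
    have e2 : ∫ x in Set.Ioo (m - c) (m + c), p (x - m) * h x =
       ∫ x in Set.Ioo (m - c) (m + c), (κ ^ 2 * (Real.cos (κ * (x - m)) ^ 2 * h x) - (κ * -Real.sin (κ * (x - m))) ^ 2 * h x) := by
      congr 1
      ext x
      simp only [p]
      rw [mul_assoc 2, Real.cos_two_mul]
      have := Real.sin_sq_add_cos_sq (κ * (x - m))
      have e : Real.sin (κ * (x - m)) ^ 2 = 1 - Real.cos (κ * (x - m)) ^ 2 := by linarith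
      rw [mul_neg, neg_sq, mul_pow, e]
      ring
    rw [e2, integral_sub, integral_const_mul] at key
    · linarith
    · exact (hbdd _ (by fun_prop)).const_mul _
    · exact hbdd _ (by fun_prop)
  · intro r hr
    have hprim : ∀ x, HasDerivAt (fun x => κ / 2 * Real.sin (2 * κ * x)) (p x) x := by
      intro x
      have hl : HasDerivAt (fun x : ℝ => 2 * κ * x) (2 * κ) x := by
        simpa using (hasDerivAt_id x).const_mul (2 * κ)
      refine (hl.sin.const_mul (κ / 2)).congr_deriv ?_
      simp only [p]; ring
    rw [intervalIntegral.integral_eq_sub_of_hasDerivAt (fun x _ => hprim x) (hp.intervalIntegrable _ _)]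
    simp
    have : 0 ≤ Real.sin (2 * κ * r) := by
      apply Real.sin_nonneg_of_nonneg_of_le_pi
      · have := hr.1; positivity
      · calc 2 * κ * r ≤ 2 * κ * c := by gcongr; exact hr.2
          _ = π := by rw [hcdef]; field_simp
    positivity
  · intro t ht
    exact add_nonneg (h0 _ ⟨by linarith [ht.1, ht.2], by linarith [ht.2]⟩) (h0 _ ⟨by linarith [ht.1, ht.2], by linarith [ht.1, ht.2]⟩)
  · have := i1.add i2
    rw [intervalIntegrable_iff_integrableOn_Ioo_of_le hcpos.le] at this
    refine this.congr_fun (fun t _ => ?_) measurableSet_Ioo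
    simp; ring

lemma smooth_dirichlet {α β κ : ℝ} (hab : α < β) (hκ : 0 < κ) (hlen : κ * (β - α) < π)
    {H H' H'' F F' : ℝ → ℝ} (hHd : ∀ x, HasDerivAt H (H' x) x) (hH'c : Continuous H')
    (hH'd : ∀ x ∈ Set.Ioo α β, HasDerivAt H' (H'' x) x) (hH'' : ∀ x ∈ Set.Ioo α β, H'' x ≤ 0)
    (hHpos : ∀ x ∈ Set.Icc α β, 0 < H x)
    (hF : ∀ x, HasDerivAt F (F' x) x) (hF'c : Continuous F') (hFα : F α = 0) (hFβ : F β = 0) :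
    κ ^ 2 * ∫ x in α..β, F x ^ 2 / H x ≤ ∫ x in α..β, F' x ^ 2 / H x := by
  have hHc : Continuous H := continuous_iff_continuousAt.2 fun x => (hHd x).continuousAt
  have hFc : Continuous F := continuous_iff_continuousAt.2 fun x => (hF x).continuousAt
  set m := (α + β) / 2 with hm
  let cc : ℝ → ℝ := fun x => -(κ * Real.tan (κ * (x - m)))
  have hcos : ∀ x ∈ Set.Icc α β, 0 < Real.cos (κ * (x - m)) := by
    intro x hx
    apply Real.cos_pos_of_mem_Ioo
    have h1 : x - m ≤ (β - α) / 2 := by rw [hm]; linarith [hx.2]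
    have h2 : -((β - α) / 2) ≤ x - m := by rw [hm]; linarith [hx.1]
    constructor <;> nlinarith
  let ψ : ℝ → ℝ := fun x => H' x / (2 * H x) + cc x
  let Φ : ℝ → ℝ := fun x => F x ^ 2 * ψ x / H x
  have hccd : ∀ x ∈ Set.Icc α β, HasDerivAt cc (-κ ^ 2 - cc x ^ 2) x := by
    intro x hx
    have hl : HasDerivAt (fun x : ℝ => κ * (x - m)) κ x := by
      simpa using ((hasDerivAt_id x).sub_const m).const_mul κ
    have h1 := (Real.hasDerivAt_tan (hcos x hx).ne').comp x hl
    refine (h1.const_mul κ).neg.congr_deriv ?_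
    simp only [cc]
    have hc0 := (hcos x hx).ne'
    rw [Real.tan_eq_sin_div_cos]
    have := Real.sin_sq_add_cos_sq (κ * (x - m))
    field_simp
    linear_combination this
  have hcont : ContinuousOn Φ (Set.Icc α β) := by
    have hcc : ContinuousOn cc (Set.Icc α β) := fun x hx => (hccd x hx).continuousAt.continuousWithinAt
    have h2 : ∀ x ∈ Set.Icc α β, H x ≠ 0 := fun x hx => (hHpos x hx).ne'
    have h3 : ∀ x ∈ Set.Icc α β, 2 * H x ≠ 0 := fun x hx => mul_ne_zero two_ne_zero (h2 x hx)
    exact ((hFc.pow 2).continuousOn.mul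
      ((hH'c.continuousOn.div (hHc.const_smul (2:ℝ)).continuousOn h3).add hcc)).div hHc.continuousOn h2
  have hint1 : IntegrableOn (fun x => F' x ^ 2 / H x) (Set.Icc α β) :=
    (ContinuousOn.div (hF'c.pow 2).continuousOn hHc.continuousOn (fun x hx => (hHpos x hx).ne')).integrableOn_Icc
  have hint2 : IntegrableOn (fun x => F x ^ 2 / H x) (Set.Icc α β) :=
    (ContinuousOn.div (hFc.pow 2).continuousOn hHc.continuousOn (fun x hx => (hHpos x hx).ne')).integrableOn_Icc
  let dΦ : ℝ → ℝ := fun x =>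
    ((2 * F x * F' x) * ψ x + F x ^ 2 * ((H'' x * (2 * H x) - H' x * (2 * H' x)) / (2 * H x) ^ 2 + (-κ ^ 2 - cc x ^ 2))) / H x
      - F x ^ 2 * ψ x * H' x / H x ^ 2
  have key := intervalIntegral.sub_le_integral_of_hasDeriv_right_of_le (g := Φ) (g' := dΦ)
    (φ := fun x => F' x ^ 2 / H x - κ ^ 2 * (F x ^ 2 / H x)) hab.le hcont ?_
    (hint1.sub (hint2.const_mul _)) ?_
  · have e1 : Φ β = 0 := by simp [Φ, hFβ]
    have e2 : Φ α = 0 := by simp [Φ, hFα]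
    rw [e1, e2, intervalIntegral.integral_sub, intervalIntegral.integral_const_mul] at key
    · linarith
    · rw [intervalIntegrable_iff_integrableOn_Icc_of_le hab.le]; exact hint1
    · rw [intervalIntegrable_iff_integrableOn_Icc_of_le hab.le]; exact hint2.const_mul _
  · intro x hx
    have hx' : x ∈ Set.Icc α β := ⟨hx.1.le, hx.2.le⟩
    have hH0 := (hHpos x hx').ne'
    have h1 : HasDerivAt ψ _ x := ((hH'd x hx).div ((hHd x).const_mul 2) (mul_ne_zero two_ne_zero hH0)).add (hccd x hx')
    have h2 : HasDerivAt Φ _ x := (((hF x).pow 2).mul h1).div (hHd x) hH0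
    refine (h2.congr_deriv ?_).hasDerivWithinAt
    simp only [dΦ, Pi.pow_apply, Pi.mul_apply]
    field_simp
    push_cast
    ring
  · intro x hx
    have hx' : x ∈ Set.Icc α β := ⟨hx.1.le, hx.2.le⟩
    have hH0 := hHpos x hx'
    have hH2 := hH'' x hx
    have : F' x ^ 2 / H x - κ ^ 2 * (F x ^ 2 / H x) - dΦ x =
        (F' x - F x * ψ x) ^ 2 / H x + F x ^ 2 * (3 * (H' x / (2 * H x)) ^ 2 + (- H'' x) / (2 * H x)) / H x := by
      simp only [dΦ, ψ]
      field_simp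
      ring
    have h2 : 0 ≤ (F' x - F x * ψ x) ^ 2 / H x + F x ^ 2 * (3 * (H' x / (2 * H x)) ^ 2 + (- H'' x) / (2 * H x)) / H x := by
      have : 0 ≤ -H'' x := by linarith
      positivity
    show dΦ x ≤ F' x ^ 2 / H x - κ ^ 2 * (F x ^ 2 / H x)
    linarith

lemma smooth_poincare0 {α β κ : ℝ} (hab : α < β) (hκ : 0 < κ) (hlen : κ * (β - α) < π)
    {H H' H'' f f' : ℝ → ℝ} (hHd : ∀ x, HasDerivAt H (H' x) x) (hH'c : Continuous H')
    (hH'd : ∀ x ∈ Set.Ioo α β, HasDerivAt H' (H'' x) x) (hH'' : ∀ x ∈ Set.Ioo α β, H'' x ≤ 0)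
    (hHpos : ∀ x ∈ Set.Icc α β, 0 < H x)
    (hf : ∀ x, HasDerivAt f (f' x) x) (hf'c : Continuous f') (hmean : ∫ x in α..β, f x * H x = 0) :
    κ ^ 2 * ∫ x in α..β, f x ^ 2 * H x ≤ ∫ x in α..β, f' x ^ 2 * H x := by
  have hHc : Continuous H := continuous_iff_continuousAt.2 fun x => (hHd x).continuousAt
  have hfc : Continuous f := continuous_iff_continuousAt.2 fun x => (hf x).continuousAt
  have hfH : Continuous fun x => f x * H x := hfc.mul hHc
  let F : ℝ → ℝ := fun x => ∫ t in α..x, f t * H t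
  have hF : ∀ x, HasDerivAt F (f x * H x) x := fun x =>
    intervalIntegral.integral_hasDerivAt_right (hfH.intervalIntegrable _ _)
      (hfH.stronglyMeasurableAtFilter _ _) hfH.continuousAt
  have hFc : Continuous F := continuous_iff_continuousAt.2 fun x => (hF x).continuousAt
  have hFα : F α = 0 := by simp [F]
  have hFβ : F β = 0 := hmean
  have key := smooth_dirichlet hab hκ hlen hHd hH'c hH'd hH'' hHpos hF hfH hFα hFβ
  have hH0 : ∀ x ∈ Set.uIcc α β, H x ≠ 0 := by
    rw [Set.uIcc_of_le hab.le]; exact fun x hx => (hHpos x hx).ne'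
  have e1 : ∫ x in α..β, (f x * H x) ^ 2 / H x = ∫ x in α..β, f x ^ 2 * H x := by
    refine intervalIntegral.integral_congr fun x hx => ?_
    have := hH0 x hx
    field_simp
  rw [e1] at key
  have e2 : ∫ x in α..β, (f' x * F x + f x * (f x * H x)) = 0 := by
    rw [intervalIntegral.integral_eq_sub_of_hasDerivAt (f := fun x => f x * F x) (fun x _ => (hf x).mul (hF x))]
    · simp [hFα, hFβ]
    · apply Continuous.intervalIntegrable; fun_prop
  have i2 : IntervalIntegrable (fun x => F x ^ 2 / H x) volume α β := by
    apply ContinuousOn.intervalIntegrable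
    exact ContinuousOn.div (hFc.pow 2).continuousOn hHc.continuousOn hH0
  have e3 : 0 ≤ ∫ x in α..β, ((f' x ^ 2 * H x / κ ^ 2 + κ ^ 2 * (F x ^ 2 / H x)) / 2 + f' x * F x) := by
    apply intervalIntegral.integral_nonneg hab.le
    intro x hx
    have h0 := hHpos x hx
    have : (f' x ^ 2 * H x / κ ^ 2 + κ ^ 2 * (F x ^ 2 / H x)) / 2 + f' x * F x
      = (f' x * H x / κ + κ * F x) ^ 2 / (2 * H x) := by field_simp; ring
    rw [this]; positivity
  have i1 : IntervalIntegrable (fun x => f' x ^ 2 * H x) volume α β := Continuous.intervalIntegrable (by fun_prop) _ _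
  have i3 : IntervalIntegrable (fun x => f' x * F x) volume α β := Continuous.intervalIntegrable (by fun_prop) _ _
  have i4 : IntervalIntegrable (fun x => f x * (f x * H x)) volume α β := Continuous.intervalIntegrable (by fun_prop) _ _
  rw [intervalIntegral.integral_add i3 i4] at e2
  rw [intervalIntegral.integral_add (((i1.div_const _).add (i2.const_mul _)).div_const _) i3,
    intervalIntegral.integral_div, intervalIntegral.integral_add (i1.div_const _) (i2.const_mul _),
    intervalIntegral.integral_div, intervalIntegral.integral_const_mul] at e3
  have e4 : ∫ x in α..β, f x * (f x * H x) = ∫ x in α..β, f x ^ 2 * H x := by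
    congr 1; ext x; ring
  rw [e4] at e2
  have : ∫ x in α..β, f x ^ 2 * H x ≤ (∫ x in α..β, f' x ^ 2 * H x) / κ ^ 2 := by linarith
  rw [le_div_iff₀ (by positivity)] at this
  linarith

lemma smooth_poincare {α β κ : ℝ} (hab : α < β) (hκ : 0 < κ) (hlen : κ * (β - α) < π)
    {H H' H'' f f' : ℝ → ℝ} (hHd : ∀ x, HasDerivAt H (H' x) x) (hH'c : Continuous H')
    (hH'd : ∀ x ∈ Set.Ioo α β, HasDerivAt H' (H'' x) x) (hH'' : ∀ x ∈ Set.Ioo α β, H'' x ≤ 0)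
    (hHpos : ∀ x ∈ Set.Icc α β, 0 < H x)
    (hf : ∀ x, HasDerivAt f (f' x) x) (hf'c : Continuous f') :
    κ ^ 2 * ((∫ x in α..β, f x ^ 2 * H x) * (∫ x in α..β, 1 * H x) - (∫ x in α..β, f x * H x) ^ 2)
      ≤ (∫ x in α..β, f' x ^ 2 * H x) * (∫ x in α..β, 1 * H x) := by
  have hHc : Continuous H := continuous_iff_continuousAt.2 fun x => (hHd x).continuousAt
  have hfc : Continuous f := continuous_iff_continuousAt.2 fun x => (hf x).continuousAt
  simp only [one_mul]
  have hpos : 0 < ∫ x in α..β, H x := by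
    apply intervalIntegral.intervalIntegral_pos_of_pos_on (hHc.intervalIntegrable _ _) _ hab
    intro x hx; exact hHpos x ⟨hx.1.le, hx.2.le⟩
  set N := ∫ x in α..β, H x with hN
  set m := (∫ x in α..β, f x * H x) / N with hm
  have hmN : ∫ x in α..β, f x * H x = m * N := by rw [hm]; field_simp
  have i1 : IntervalIntegrable (fun x => f x * H x) volume α β := Continuous.intervalIntegrable (by fun_prop) _ _
  have i2 : IntervalIntegrable (fun x => f x ^ 2 * H x) volume α β := Continuous.intervalIntegrable (by fun_prop) _ _
  have i3 : IntervalIntegrable H volume α β := hHc.intervalIntegrable _ _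
  have key := smooth_poincare0 hab hκ hlen hHd hH'c hH'd hH'' hHpos (f := fun x => f x - m) (f' := f')
    (fun x => (hf x).sub_const m) hf'c ?_
  · have e : ∫ x in α..β, (f x - m) ^ 2 * H x = ∫ x in α..β, (f x ^ 2 * H x - 2 * m * (f x * H x) + m ^ 2 * H x) := by
      congr 1; ext x; ring
    rw [e, intervalIntegral.integral_add (i2.sub (i1.const_mul _)) (i3.const_mul _), intervalIntegral.integral_sub i2 (i1.const_mul _),
      intervalIntegral.integral_const_mul, intervalIntegral.integral_const_mul, hmN, ← hN] at key
    rw [hmN]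
    have := mul_le_mul_of_nonneg_right key hpos.le
    calc _ = _ := ?_
      _ ≤ _ := this
    ring
  · have e : ∫ x in α..β, (f x - m) * H x = ∫ x in α..β, (f x * H x - m * H x) := by
      congr 1; ext x; ring
    show ∫ x in α..β, (f x - m) * H x = 0
    rw [e, intervalIntegral.integral_sub i1 (i3.const_mul _), intervalIntegral.integral_const_mul, hmN, ← hN]
    ring

/-- double average of a function, via its second antiderivative -/
def avA1 (h : ℝ → ℝ) (x : ℝ) : ℝ := ∫ t in (0:ℝ)..x, h t
def avA2 (h : ℝ → ℝ) (x : ℝ) : ℝ := ∫ t in (0:ℝ)..x, avA1 h t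
def avH (h : ℝ → ℝ) (ε x : ℝ) : ℝ := (avA2 h (x + 2 * ε) - 2 * avA2 h (x + ε) + avA2 h x) / ε ^ 2
def avH' (h : ℝ → ℝ) (ε x : ℝ) : ℝ := (avA1 h (x + 2 * ε) - 2 * avA1 h (x + ε) + avA1 h x) / ε ^ 2


lemma avA1_cont {h : ℝ → ℝ} (hi : Integrable h) : Continuous (avA1 h) := intervalIntegral.continuous_primitive (fun a b => hi.intervalIntegrable) 0

lemma avA2_deriv {h : ℝ → ℝ} (hi : Integrable h) (x : ℝ) : HasDerivAt (avA2 h) (avA1 h x) x :=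
  intervalIntegral.integral_hasDerivAt_right ((avA1_cont hi).intervalIntegrable _ _)
      ((avA1_cont hi).stronglyMeasurableAtFilter _ _) (avA1_cont hi).continuousAt

lemma avH_deriv {h : ℝ → ℝ} (hi : Integrable h) (ε x : ℝ) : HasDerivAt (avH h ε) (avH' h ε x) x := by
  have h1 := (avA2_deriv hi (x + 2 * ε)).comp_add_const x (2 * ε)
  have h2 := (avA2_deriv hi (x + ε)).comp_add_const x ε
  exact ((h1.sub (h2.const_mul 2)).add (avA2_deriv hi x)).div_const (ε ^ 2)

lemma avH'_cont {h : ℝ → ℝ} (hi : Integrable h) (ε : ℝ) : Continuous (avH' h ε) := by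
  have := avA1_cont hi
  unfold avH'
  fun_prop

lemma avA1_deriv {h : ℝ → ℝ} (hi : Integrable h) {x : ℝ} (hm : Measurable h) (hx : ContinuousAt h x) : HasDerivAt (avA1 h) (h x) x :=
  intervalIntegral.integral_hasDerivAt_right hi.intervalIntegrable
      (hm.stronglyMeasurable.stronglyMeasurableAtFilter) hx

lemma avH'_deriv {h : ℝ → ℝ} (hi : Integrable h) {ε x : ℝ} (hm : Measurable h) (h1 : ContinuousAt h x) (h2 : ContinuousAt h (x + ε))
   (h3 : ContinuousAt h (x + 2 * ε)) :
   HasDerivAt (avH' h ε) ((h (x + 2 * ε) - 2 * h (x + ε) + h x) / ε ^ 2) x := by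
  have d1 := (avA1_deriv hi hm h3).comp_add_const x (2 * ε)
  have d2 := (avA1_deriv hi hm h2).comp_add_const x ε
  exact ((d1.sub (d2.const_mul 2)).add (avA1_deriv hi hm h1)).div_const (ε ^ 2)

lemma avH_eq {h : ℝ → ℝ} (hi : Integrable h) (ε x : ℝ) : avH h ε x = (∫ t in x..(x+ε), ∫ s in t..(t+ε), h s) / ε ^ 2 := by
  have c := avA1_cont hi
  have e1 : ∀ t, ∫ s in t..(t+ε), h s = avA1 h (t + ε) - avA1 h t := by
    intro t
    unfold avA1
    rw [eq_sub_iff_add_eq, add_comm, intervalIntegral.integral_add_adjacent_intervals hi.intervalIntegrable hi.intervalIntegrable]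
  unfold avH
  congr 1
  simp only [e1]
  rw [intervalIntegral.integral_sub]
  · rw [intervalIntegral.integral_comp_add_right (fun t => avA1 h t) ε]
    have e2 : ∀ a b, ∫ t in a..b, avA1 h t = avA2 h b - avA2 h a := by
      intro a b
      unfold avA2
      rw [eq_sub_iff_add_eq, add_comm, intervalIntegral.integral_add_adjacent_intervals (c.intervalIntegrable _ _) (c.intervalIntegrable _ _)]
    rw [e2, e2]
    have : x + ε + ε = x + 2 * ε := by ring
    rw [this]; ring
  · apply Continuous.intervalIntegrable; fun_prop
  · apply Continuous.intervalIntegrable; fun_prop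

lemma avH_ge {h : ℝ → ℝ} (hi : Integrable h) {ε x m : ℝ} (hε : 0 < ε) (hm : ∀ s ∈ Set.Icc x (x + 2 * ε), m ≤ h s) : m ≤ avH h ε x := by
  have c := avA1_cont hi
  rw [avH_eq hi, le_div_iff₀ (by positivity)]
  have inner : ∀ t ∈ Set.Icc x (x + ε), m * ε ≤ ∫ s in t..(t+ε), h s := by
    intro t ht
    have : ∫ s in t..(t+ε), (fun _ => m) s ≤ ∫ s in t..(t+ε), h s := by
      apply intervalIntegral.integral_mono_on (by linarith) (by simp) hi.intervalIntegrable
      intro s hs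
      exact hm s ⟨by linarith [ht.1, hs.1], by linarith [ht.2, hs.2]⟩
    simpa [mul_comm] using this
  have e1 : (fun t => ∫ s in t..(t+ε), h s) = fun t => avA1 h (t + ε) - avA1 h t := by
    ext t
    unfold avA1
    rw [eq_sub_iff_add_eq, add_comm, intervalIntegral.integral_add_adjacent_intervals hi.intervalIntegrable hi.intervalIntegrable]
  have : ∫ t in x..(x+ε), (fun _ => m * ε) t ≤ ∫ t in x..(x+ε), ∫ s in t..(t+ε), h s := by
    apply intervalIntegral.integral_mono_on (by linarith) (by simp) _ inner
    rw [e1]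
    apply Continuous.intervalIntegrable; fun_prop
  simp at this
  linarith

lemma avH_neg {h : ℝ → ℝ} (hi : Integrable h) (ε x : ℝ) : avH (fun x => - h x) ε x = - avH h ε x := by
  have e := avH_eq hi.neg ε x
  have e' : avH (fun x => - h x) ε x = _ := e
  rw [avH_eq hi, e']
  simp [neg_div]

lemma avH_le {h : ℝ → ℝ} (hi : Integrable h) {ε x m : ℝ} (hε : 0 < ε) (hm : ∀ s ∈ Set.Icc x (x + 2 * ε), h s ≤ m) : avH h ε x ≤ m := by
  have := avH_ge hi.neg hε (x := x) (m := -m) (fun s hs => by simpa using hm s hs)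
  have e := avH_neg hi ε x
  have e' : avH (-h) ε x = - avH h ε x := e
  linarith

lemma avH_tendsto {h : ℝ → ℝ} (hi : Integrable h) {x : ℝ} (hx : ContinuousAt h x) : Tendsto (fun ε => avH h ε x) (𝓝[>] 0) (𝓝 (h x)) := by
  rw [Metric.tendsto_nhds]
  intro η hη
  obtain ⟨δ, hδ, hd⟩ := Metric.continuousAt_iff.1 hx (η / 2) (by positivity)
  filter_upwards [Ioo_mem_nhdsGT (show (0:ℝ) < δ / 4 by positivity)] with ε hε
  have hs : ∀ s ∈ Set.Icc x (x + 2 * ε), |h s - h x| < η / 2 := by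
    intro s hs
    apply hd
    rw [Real.dist_eq, abs_of_nonneg (by linarith [hs.1])]
    linarith [hs.2, hε.2]
  have h1 := avH_ge hi hε.1 (x := x) (m := h x - η / 2) (fun s hs' => by have := abs_lt.1 (hs s hs'); linarith)
  have h2 := avH_le hi hε.1 (x := x) (m := h x + η / 2) (fun s hs' => by have := abs_lt.1 (hs s hs'); linarith)
  rw [Real.dist_eq, abs_lt]
  constructor <;> linarith

/-- Weighted Poincare (Payne-Weinberger) inequality in one dimension with concave weight. -/
lemma concave_poincare {l M : ℝ} (hl : 0 < l) {h f f' : ℝ → ℝ}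
    (hc : ConcaveOn ℝ (Set.Ioo 0 l) h) (hpos : ∀ x ∈ Set.Ioo 0 l, 0 < h x) (hM : ∀ x ∈ Set.Ioo 0 l, h x ≤ M)
    (hf : ∀ x, HasDerivAt f (f' x) x) (hf'c : Continuous f') :
    (π / l) ^ 2 * ((∫ x in Set.Ioo 0 l, f x ^ 2 * h x) * (∫ x in Set.Ioo 0 l, 1 * h x) - (∫ x in Set.Ioo 0 l, f x * h x) ^ 2)
      ≤ (∫ x in Set.Ioo 0 l, f' x ^ 2 * h x) * (∫ x in Set.Ioo 0 l, 1 * h x) := by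
  have hfc : Continuous f := continuous_iff_continuousAt.2 fun x => (hf x).continuousAt
  have hcon : ContinuousOn h (Set.Ioo 0 l) := hc.continuousOn isOpen_Ioo
  set g : ℝ → ℝ := (Set.Ioo 0 l).indicator h with hg
  have hgeq : ∀ x ∈ Set.Ioo 0 l, g x = h x := fun x hx => Set.indicator_of_mem hx h
  have hgcon : ∀ x ∈ Set.Ioo 0 l, ContinuousAt g x := by
    intro x hx
    have := hcon.continuousAt (isOpen_Ioo.mem_nhds hx)
    refine this.congr ?_
    filter_upwards [isOpen_Ioo.mem_nhds hx] with y hy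
    exact (hgeq y hy).symm
  have hgm : Measurable g := by
    have := hcon.measurable_piecewise (g := (0 : ℝ → ℝ)) continuousOn_const measurableSet_Ioo
    rwa [Set.piecewise_eq_indicator] at this
  have hM0 : 0 ≤ M := by
    have := hpos (l/2) ⟨by positivity, by linarith⟩
    have := hM (l/2) ⟨by positivity, by linarith⟩
    linarith
  have hg0 : ∀ x, 0 ≤ g x := by
    intro x; by_cases hx : x ∈ Set.Ioo 0 l
    · rw [hgeq x hx]; exact (hpos x hx).le
    · rw [hg, Set.indicator_of_notMem hx]
  have hgM : ∀ x, g x ≤ M := by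
    intro x; by_cases hx : x ∈ Set.Ioo 0 l
    · rw [hgeq x hx]; exact hM x hx
    · rw [hg, Set.indicator_of_notMem hx]; exact hM0
  have hgi : Integrable g := by
    rw [hg, integrable_indicator_iff measurableSet_Ioo]
    refine Integrable.mono' (g := fun _ => M) (integrable_const _) (hcon.aestronglyMeasurable measurableSet_Ioo) ?_
    filter_upwards [ae_restrict_mem measurableSet_Ioo] with x hx
    rw [Real.norm_of_nonneg (hpos x hx).le]; exact hM x hx
  have hHc : ∀ ε, Continuous (avH g ε) := fun ε => continuous_iff_continuousAt.2 fun x => (avH_deriv hgi ε x).continuousAt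
  have lim : ∀ φ : ℝ → ℝ, Continuous φ → Tendsto (fun ε => ∫ x in ε..(l - 3 * ε), φ x * avH g ε x) (𝓝[>] 0)
      (𝓝 (∫ x in Set.Ioo 0 l, φ x * h x)) := by
    intro φ hφ
    obtain ⟨C, hC⟩ := (isCompact_Icc (a := (0:ℝ)) (b := l)).exists_bound_of_continuousOn hφ.continuousOn
    have hC0 : 0 ≤ C := (norm_nonneg _).trans (hC 0 ⟨le_rfl, hl.le⟩)
    have e1 : ∀ᶠ ε in 𝓝[>] (0:ℝ), ∫ x in Set.Ioo 0 l, (Set.Ioc ε (l - 3 * ε)).indicator (fun x => φ x * avH g ε x) x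
        = ∫ x in ε..(l - 3 * ε), φ x * avH g ε x := by
      filter_upwards [Ioo_mem_nhdsGT (show (0:ℝ) < l / 8 by positivity)] with ε hε
      rw [intervalIntegral.integral_of_le (by linarith [hε.2]), integral_indicator measurableSet_Ioc,
        Measure.restrict_restrict measurableSet_Ioc, Set.inter_eq_left.2]
      intro x hx
      exact ⟨hε.1.trans hx.1, by linarith [hx.2, hε.1]⟩
    refine Tendsto.congr' e1 ?_
    refine tendsto_integral_filter_of_dominated_convergence (fun _ => C * M) ?_ ?_ ?_ ?_
    · refine Eventually.of_forall fun ε => ?_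
      exact ((hφ.mul (hHc ε)).measurable.indicator measurableSet_Ioc).aestronglyMeasurable
    · filter_upwards [self_mem_nhdsWithin] with ε hε
      filter_upwards [ae_restrict_mem measurableSet_Ioo] with x hx
      refine (norm_indicator_le_norm_self _ _).trans ?_
      rw [norm_mul]
      have h1 := avH_ge hgi (x := x) hε (m := 0) (fun s _ => hg0 s)
      have h2 := avH_le hgi (x := x) hε (m := M) (fun s _ => hgM s)
      rw [Real.norm_of_nonneg h1]
      exact mul_le_mul (hC x ⟨hx.1.le, hx.2.le⟩) h2 h1 hC0
    · exact integrable_const _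
    · filter_upwards [ae_restrict_mem measurableSet_Ioo] with x hx
      have t1 := avH_tendsto hgi (hgcon x hx)
      rw [hgeq x hx] at t1
      refine Tendsto.congr' ?_ (t1.const_mul (φ x))
      filter_upwards [Ioo_mem_nhdsGT (show (0:ℝ) < min x ((l - x)/4) from lt_min hx.1 (by linarith [hx.2]))] with ε hε
      rw [Set.indicator_of_mem]
      have h1 := hε.2.trans_le (min_le_left _ _)
      have h2 := hε.2.trans_le (min_le_right _ _)
      exact ⟨h1, by linarith [hε.1]⟩
  have L1 := lim (fun x => f x ^ 2) (by fun_prop)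
  have L2 := lim (fun x => 1) (by fun_prop)
  have L3 := lim f hfc
  have L4 := lim (fun x => f' x ^ 2) (by fun_prop)
  refine le_of_tendsto_of_tendsto (((L1.mul L2).sub (L3.pow 2)).const_mul ((π / l) ^ 2)) (L4.mul L2) ?_
  filter_upwards [Ioo_mem_nhdsGT (show (0:ℝ) < l / 8 by positivity)] with ε hε
  have hε1 := hε.1
  have hε2 := hε.2
  refine smooth_poincare (H := avH g ε) (H' := avH' g ε) (H'' := fun x => (g (x + 2 * ε) - 2 * g (x + ε) + g x) / ε ^ 2)
    (by linarith) (by positivity) ?_ (avH_deriv hgi ε) (avH'_cont hgi ε) ?_ ?_ ?_ hf hf'c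
  · have : π / l * (l - 3 * ε - ε) < π / l * l := by
      apply mul_lt_mul_of_pos_left (by linarith) (by positivity)
    rwa [div_mul_cancel₀ _ hl.ne'] at this
  · intro x hx
    exact avH'_deriv hgi hgm (hgcon _ ⟨by linarith [hx.1], by linarith [hx.2]⟩) (hgcon _ ⟨by linarith [hx.1], by linarith [hx.2]⟩)
      (hgcon _ ⟨by linarith [hx.1], by linarith [hx.2]⟩)
  · intro x hx
    have m1 : x ∈ Set.Ioo 0 l := ⟨by linarith [hx.1], by linarith [hx.2]⟩
    have m2 : x + ε ∈ Set.Ioo 0 l := ⟨by linarith [hx.1], by linarith [hx.2]⟩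
    have m3 : x + 2 * ε ∈ Set.Ioo 0 l := ⟨by linarith [hx.1], by linarith [hx.2]⟩
    have := hc.2 m1 m3 (show (0:ℝ) ≤ 1/2 by norm_num) (show (0:ℝ) ≤ 1/2 by norm_num) (by norm_num)
    simp only [smul_eq_mul] at this
    have e : 1 / 2 * x + 1 / 2 * (x + 2 * ε) = x + ε := by ring
    rw [e] at this
    show (g (x + 2 * ε) - 2 * g (x + ε) + g x) / ε ^ 2 ≤ 0
    rw [hgeq _ m1, hgeq _ m2, hgeq _ m3]
    apply div_nonpos_of_nonpos_of_nonneg _ (by positivity)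
    linarith
  · intro x hx
    have hsub : Set.Icc x (x + 2 * ε) ⊆ Set.Ioo 0 l := fun s hs => ⟨by linarith [hs.1, hx.1], by linarith [hs.2, hx.2]⟩
    obtain ⟨y, hy, hmin⟩ := (isCompact_Icc (a := x) (b := x + 2 * ε)).exists_isMinOn ⟨x, ⟨le_rfl, by linarith⟩⟩ (hcon.mono hsub)
    have := avH_ge hgi (x := x) hε1 (m := h y) (fun s hs => by rw [hgeq s (hsub hs)]; exact hmin hs)
    exact (hpos y (hsub hy)).trans_le this

def Phi (p : Euc 2) (b : OrthonormalBasis (Fin 2) ℝ (Euc 2)) (v : ℝ × ℝ) : Euc 2 :=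
  p + (v.1 • b 0 + v.2 • b 1)

lemma Phi_eq (p : Euc 2) (b : OrthonormalBasis (Fin 2) ℝ (Euc 2)) (v : ℝ × ℝ) :
    Phi p b v = p + b.repr.symm (WithLp.toLp 2 ((MeasurableEquiv.finTwoArrow (α := ℝ)).symm v)) := by
  rw [← OrthonormalBasis.sum_repr_symm, Fin.sum_univ_two]
  simp [Phi, MeasurableEquiv.finTwoArrow]

lemma Phi_continuous (p : Euc 2) (b : OrthonormalBasis (Fin 2) ℝ (Euc 2)) : Continuous (Phi p b) := by
  unfold Phi; fun_prop

lemma Phi_mp (p : Euc 2) (b : OrthonormalBasis (Fin 2) ℝ (Euc 2)) :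
    MeasurePreserving (Phi p b) volume volume := by
  have h1 : MeasurePreserving (MeasurableEquiv.finTwoArrow (α := ℝ)).symm volume volume :=
    (volume_preserving_finTwoArrow ℝ).symm _
  have h2 := PiLp.volume_preserving_toLp (Fin 2)
  have h3 := b.repr.symm.measurePreserving
  have h4 := measurePreserving_add_left (volume : Measure (Euc 2)) p
  have := h4.comp (h3.comp (h2.comp h1))
  have e : Phi p b = (fun x => p + x) ∘ (b.repr.symm ∘ (WithLp.toLp 2 ∘ (MeasurableEquiv.finTwoArrow (α := ℝ)).symm)) := by
    funext v; exact Phi_eq p b v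
  rw [e]; exact this

lemma b_inner (b : OrthonormalBasis (Fin 2) ℝ (Euc 2)) : inner ℝ (b 0) (b 0) = 1 ∧ inner ℝ (b 1) (b 1) = 1 ∧
    inner ℝ (b 0) (b 1) = 0 ∧ inner ℝ (b 1) (b 0) = 0 := by
  have := b.orthonormal
  rw [orthonormal_iff_ite] at this
  refine ⟨by simpa using this 0 0, by simpa using this 1 1, by simpa using this 0 1, by simpa using this 1 0⟩

lemma Phi_dist (p : Euc 2) (b : OrthonormalBasis (Fin 2) ℝ (Euc 2)) (v w : ℝ × ℝ) :
    dist (Phi p b v) (Phi p b w) ^ 2 = (v.1 - w.1)^2 + (v.2 - w.2)^2 := by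
  obtain ⟨h1, h2, h3, h4⟩ := b_inner b
  rw [dist_eq_norm, ← real_inner_self_eq_norm_sq]
  have : Phi p b v - Phi p b w = (v.1 - w.1) • b 0 + (v.2 - w.2) • b 1 := by
    unfold Phi; module
  rw [this]
  simp only [inner_add_left, inner_add_right, inner_smul_left, inner_smul_right, h1, h2, h3, h4]
  simp; ring

lemma Phi_coord (p : Euc 2) (b : OrthonormalBasis (Fin 2) ℝ (Euc 2)) (v : ℝ × ℝ) :
    inner ℝ (b 0) (Phi p b v - p) = v.1 ∧ inner ℝ (b 1) (Phi p b v - p) = v.2 := by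
  obtain ⟨h1, h2, h3, h4⟩ := b_inner b
  have : Phi p b v - p = v.1 • b 0 + v.2 • b 1 := by unfold Phi; module
  rw [this]
  simp only [inner_add_right, inner_smul_right, h1, h2, h3, h4]
  simp

lemma Phi_inj (p : Euc 2) (b : OrthonormalBasis (Fin 2) ℝ (Euc 2)) : Function.Injective (Phi p b) := by
  intro v w h
  have h1 := Phi_coord p b v
  have h2 := Phi_coord p b w
  rw [h] at h1
  exact Prod.ext (h1.1.symm.trans h2.1) (h1.2.symm.trans h2.2)

lemma Phi_surj (p : Euc 2) (b : OrthonormalBasis (Fin 2) ℝ (Euc 2)) (z : Euc 2) :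
    Phi p b (inner ℝ (b 0) (z - p), inner ℝ (b 1) (z - p)) = z := by
  have := b.sum_repr' (z - p)
  rw [Fin.sum_univ_two] at this
  unfold Phi
  simp only
  rw [this]; abel

lemma Phi_emb (p : Euc 2) (b : OrthonormalBasis (Fin 2) ℝ (Euc 2)) : MeasurableEmbedding (Phi p b) :=
  (Phi_continuous p b).measurableEmbedding (Phi_inj p b)

lemma setIntegral_Phi (p : Euc 2) (b : OrthonormalBasis (Fin 2) ℝ (Euc 2)) (K : Set (Euc 2)) (F : Euc 2 → ℝ) :
    ∫ z in K, F z = ∫ v in Phi p b ⁻¹' K, F (Phi p b v) :=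
  ((Phi_mp p b).setIntegral_preimage_emb (Phi_emb p b) F K).symm


lemma oneD_vol {S : Set ℝ} (hc : Convex ℝ S) (hne : S.Nonempty) (hb : Bornology.IsBounded S) :
    volume.real S = sSup S - sInf S := by
  have hle : sInf S ≤ sSup S := by
    obtain ⟨x, hx⟩ := hne
    exact (csInf_le hb.bddBelow hx).trans (le_csSup hb.bddAbove hx)
  have h1 : Set.Ioo (sInf S) (sSup S) ⊆ S :=
    IsConnected.Ioo_csInf_csSup_subset ⟨hne, hc.isPreconnected⟩ hb.bddBelow hb.bddAbove
  have h2 : S ⊆ Set.Icc (sInf S) (sSup S) := fun x hx => ⟨csInf_le hb.bddBelow hx, le_csSup hb.bddAbove hx⟩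
  have h3 := measureReal_mono (μ := volume) h1 hb.measure_lt_top.ne
  have h4 := measureReal_mono (μ := volume) h2 (by simp)
  rw [Real.volume_real_Ioo_of_le hle] at h3
  rw [Real.volume_real_Icc_of_le hle] at h4
  linarith

lemma oneD_BM {A B C : Set ℝ} {s t : ℝ} (hs : 0 ≤ s) (ht : 0 ≤ t) (hst : s + t = 1)
    (hA : Convex ℝ A) (hB : Convex ℝ B) (hC : Convex ℝ C) (hAn : A.Nonempty) (hBn : B.Nonempty)
    (hAb : Bornology.IsBounded A) (hBb : Bornology.IsBounded B) (hCb : Bornology.IsBounded C)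
    (h : ∀ a ∈ A, ∀ b ∈ B, s * a + t * b ∈ C) :
    s * volume.real A + t * volume.real B ≤ volume.real C := by
  have hCn : C.Nonempty := by
    obtain ⟨a, ha⟩ := hAn; obtain ⟨b, hb⟩ := hBn
    exact ⟨_, h a ha b hb⟩
  rw [oneD_vol hA hAn hAb, oneD_vol hB hBn hBb, oneD_vol hC hCn hCb]
  have key : ∀ ε > 0, s * (sSup A - sInf A) + t * (sSup B - sInf B) ≤ sSup C - sInf C + ε := by
    intro ε hε
    obtain ⟨a, ha, ha'⟩ := exists_lt_of_lt_csSup hAn (show sSup A - ε/2 < sSup A by linarith)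
    obtain ⟨b, hb, hb'⟩ := exists_lt_of_lt_csSup hBn (show sSup B - ε/2 < sSup B by linarith)
    obtain ⟨c, hc, hc'⟩ := exists_lt_of_csInf_lt hAn (show sInf A < sInf A + ε/2 by linarith)
    obtain ⟨d, hd, hd'⟩ := exists_lt_of_csInf_lt hBn (show sInf B < sInf B + ε/2 by linarith)
    have h1 := le_csSup hCb.bddAbove (h a ha b hb)
    have h2 := csInf_le hCb.bddBelow (h c hc d hd)
    have e1 := mul_le_mul_of_nonneg_left ha'.le hs
    have e2 := mul_le_mul_of_nonneg_left hb'.le ht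
    have e3 := mul_le_mul_of_nonneg_left hc'.le hs
    have e4 := mul_le_mul_of_nonneg_left hd'.le ht
    have e5 : t = 1 - s := by linarith
    subst e5
    nlinarith
  exact le_of_forall_pos_le_add key

def slh (T : Set (ℝ × ℝ)) (x : ℝ) : ℝ := volume.real {y : ℝ | (x, y) ∈ T}

lemma slice_facts {T : Set (ℝ × ℝ)} {l R : ℝ} (hT : IsOpen T) (hc : Convex ℝ T)
    (hsub : ∀ v ∈ T, v.1 ∈ Set.Ioo 0 l ∧ v.2 ∈ Set.Icc (-R) R)
    (hne : ∀ x ∈ Set.Ioo 0 l, ∃ y, (x, y) ∈ T) :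
    ConcaveOn ℝ (Set.Ioo 0 l) (slh T) ∧ (∀ x ∈ Set.Ioo 0 l, 0 < slh T x) ∧
    (∀ x, slh T x ≤ 2 * |R|) ∧
    (∀ g : ℝ → ℝ, Continuous g → ∫ v in T, g v.1 = ∫ x in Set.Ioo 0 l, g x * slh T x) := by
  have hsb : ∀ x, Bornology.IsBounded {y : ℝ | (x, y) ∈ T} := fun x =>
    (Metric.isBounded_Icc (-R) R).subset (fun y hy => (hsub _ hy).2)
  have hsc : ∀ x, Convex ℝ {y : ℝ | (x, y) ∈ T} := by
    intro x y hy y' hy' a b ha hb hab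
    have := hc hy hy' ha hb hab
    have e : a • (x, y) + b • (x, y') = (x, a • y + b • y') := by
      ext
      · simp [← add_mul, hab]
      · simp
    rw [e] at this; exact this
  have hso : ∀ x, IsOpen {y : ℝ | (x, y) ∈ T} := fun x => hT.preimage (by fun_prop : Continuous fun y : ℝ => (x, y))
  refine ⟨⟨convex_Ioo _ _, ?_⟩, ?_, ?_, ?_⟩
  · intro x hx x' hx' a b ha hb hab
    simp only [smul_eq_mul]
    refine oneD_BM ha hb hab (hsc _) (hsc _) (hsc _) (hne x hx) (hne x' hx') (hsb _) (hsb _) (hsb _) ?_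
    intro y hy y' hy'
    have := hc hy hy' ha hb hab
    simpa using this
  · intro x hx
    have : 0 < volume {y : ℝ | (x, y) ∈ T} := (hso x).measure_pos _ (hne x hx)
    exact ENNReal.toReal_pos this.ne' (hsb x).measure_lt_top.ne
  · intro x
    have : {y : ℝ | (x, y) ∈ T} ⊆ Set.Icc (-|R|) |R| := fun y hy => by
      have := (hsub _ hy).2
      exact ⟨by linarith [this.1, le_abs_self R], this.2.trans (le_abs_self R)⟩
    have h2 := measureReal_mono (μ := volume) this (by simp)
    rw [Real.volume_real_Icc_of_le (by linarith [abs_nonneg R])] at h2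
    show volume.real _ ≤ _
    linarith
  · intro g hg
    have hbd : Bornology.IsBounded T := ((Metric.isBounded_Icc (0:ℝ) l).prod (Metric.isBounded_Icc (-R) R)).subset
      (fun v hv => ⟨⟨(hsub v hv).1.1.le, (hsub v hv).1.2.le⟩, (hsub v hv).2⟩)
    have hInt0 : IntegrableOn (fun v : ℝ × ℝ => g v.1) T := by
      have hcl : IsCompact (closure T) := hbd.isCompact_closure
      exact ((hg.comp continuous_fst).continuousOn.integrableOn_compact hcl).mono_set subset_closure
    rw [← integral_indicator hT.measurableSet]
    rw [← integrable_indicator_iff hT.measurableSet] at hInt0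
    rw [Measure.volume_eq_prod] at hInt0 ⊢
    rw [integral_prod _ hInt0, ← integral_indicator measurableSet_Ioo]
    congr 1
    funext x
    have e : (fun y => T.indicator (fun v : ℝ × ℝ => g v.1) (x, y)) = ({y : ℝ | (x, y) ∈ T}).indicator (fun _ => g x) := by
      funext y
      by_cases hy : (x, y) ∈ T
      · rw [Set.indicator_of_mem hy, Set.indicator_of_mem (show y ∈ {y | (x,y) ∈ T} from hy)]
      · rw [Set.indicator_of_notMem hy, Set.indicator_of_notMem (show y ∉ {y | (x,y) ∈ T} from hy)]
    rw [e, integral_indicator (hso x).measurableSet, setIntegral_const, smul_eq_mul]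
    by_cases hx : x ∈ Set.Ioo 0 l
    · rw [Set.indicator_of_mem hx, mul_comm]; rfl
    · rw [Set.indicator_of_notMem hx]
      have : {y : ℝ | (x, y) ∈ T} = ∅ := by
        ext y; simp only [Set.mem_empty_iff_false, iff_false]
        intro hy; exact hx (hsub _ hy).1
      rw [this]; simp

lemma exists_diam_pts {K : Set (Euc 2)} (hK : IsConvexDomain K) :
    ∃ p ∈ closure K, ∃ q ∈ closure K, dist p q = Metric.diam K := by
  obtain ⟨hn, ho, hb, hc⟩ := hK
  have hcomp : IsCompact (closure K) := hb.isCompact_closure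
  obtain ⟨⟨p, q⟩, hpq, hmax⟩ := (hcomp.prod hcomp).exists_isMaxOn (hn.closure.prod hn.closure)
    (continuous_dist.continuousOn)
  refine ⟨p, hpq.1, q, hpq.2, le_antisymm ?_ ?_⟩
  · rw [← Metric.diam_closure]
    exact Metric.dist_le_diam_of_mem hb.closure hpq.1 hpq.2
  · apply Metric.diam_le_of_forall_dist_le dist_nonneg
    intro x hx y hy
    have h1 : (x, y) ∈ closure K ×ˢ closure K := ⟨subset_closure hx, subset_closure hy⟩
    have h2 := isMaxOn_iff.1 hmax (x, y) h1
    exact h2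

lemma diam_pos' {K : Set (Euc 2)} (hK : IsConvexDomain K) : 0 < Metric.diam K := by
  obtain ⟨⟨z, hz⟩, ho, hb, hc⟩ := hK
  obtain ⟨r, hr, hball⟩ := Metric.isOpen_iff.1 ho z hz
  let e : Euc 2 := EuclideanSpace.single 0 (1:ℝ)
  have he : ‖e‖ = 1 := by simp [e]
  have h1 : z + (r/2) • e ∈ K := by
    apply hball
    rw [Metric.mem_ball, dist_eq_norm, add_sub_cancel_left, norm_smul, he, Real.norm_of_nonneg (by positivity)]
    linarith
  have := Metric.dist_le_diam_of_mem hb h1 hz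
  rw [dist_eq_norm, add_sub_cancel_left, norm_smul, he, Real.norm_of_nonneg (by positivity)] at this
  linarith

lemma comb3 {E : Type*} [AddCommGroup E] [Module ℝ E] {C : Set E} (hC : Convex ℝ C) {x y z : E} (hx : x ∈ C) (hy : y ∈ C) (hz : z ∈ C)
    {a b c : ℝ} (ha : 0 ≤ a) (hb : 0 ≤ b) (hc : 0 ≤ c) (h : a + b + c = 1) : a • x + b • y + c • z ∈ C := by
  have := hC.sum_mem (t := Finset.univ) (w := ![a, b, c]) (z := ![x, y, z]) (by
    intro i _; fin_cases i <;> simpa) (by simpa [Fin.sum_univ_three] using h) (by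
    intro i _; fin_cases i <;> simpa)
  simpa [Fin.sum_univ_three] using this

lemma prod_small {τ ρ : ℝ} (h1 : -(1/6) ≤ τ) (h2 : τ ≤ 1/6) (h3 : 0 ≤ ρ) (h4 : ρ ≤ 1) : τ * ρ ≤ 1/6 ∧ τ * (1 - ρ) ≤ 1/6 := by
  constructor <;> nlinarith

set_option maxHeartbeats 1000000 in
theorem exists_frame {K : Set (Euc 2)} (hK : IsConvexDomain K) :
    ∃ (p e : Euc 2) (h : ℝ → ℝ) (M : ℝ), ‖e‖ = 1 ∧
      ConcaveOn ℝ (Set.Ioo 0 (Metric.diam K)) h ∧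
      (∀ x ∈ Set.Ioo 0 (Metric.diam K), 0 < h x) ∧ (∀ x, h x ≤ M) ∧
      (∀ g : ℝ → ℝ, Continuous g → ∫ z in K, g (inner ℝ e (z - p)) = ∫ x in Set.Ioo 0 (Metric.diam K), g x * h x) ∧
      (∀ z ∈ K, inner ℝ e (z - p) ∈ Set.Ioo 0 (Metric.diam K)) ∧
      (∀ x ∈ Set.Icc 0 (Metric.diam K), p + x • e ∈ closure K) ∧
      (∀ δ > 0, (∀ c, ¬ Metric.ball c δ ⊆ K) → ∀ z ∈ K, dist z (p + (inner ℝ e (z - p)) • e) ≤ 6 * δ) := by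
  have hl := diam_pos' hK
  obtain ⟨p, hp, q, hq, hpq⟩ := exists_diam_pts hK
  obtain ⟨hn, ho, hb, hc⟩ := hK
  set l := Metric.diam K with hldef
  let e : Euc 2 := (1 / l) • (q - p)
  have he : ‖e‖ = 1 := by
    simp only [e]
    rw [norm_smul, ← dist_eq_norm, dist_comm, hpq, Real.norm_of_nonneg (by positivity)]
    field_simp
  have hq' : q = p + l • e := by
    simp only [e]; rw [smul_smul, mul_one_div_cancel hl.ne', one_smul]; abel
  obtain ⟨b, hb0⟩ := Orthonormal.exists_orthonormalBasis_extension_of_card_eq (𝕜 := ℝ) (E := Euc 2) (ι := Fin 2) (by simp)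
    (v := fun i => if i = 0 then e else 0) (s := {0}) (by
      rw [orthonormal_iff_ite]
      rintro ⟨i, hi⟩ ⟨j, hj⟩
      obtain rfl : i = 0 := hi
      obtain rfl : j = 0 := hj
      simp [he])
  have hb0 : b 0 = e := by simpa using hb0 0 (by simp)
  set T := Phi p b ⁻¹' K with hTdef
  have hP0 : Phi p b (0, 0) = p := by simp [Phi]
  have hPl : Phi p b (l, 0) = q := by simp [Phi, hb0, hq']
  have hTo : IsOpen T := ho.preimage (Phi_continuous p b)
  have hTc : Convex ℝ T := by
    intro v hv w hw a c ha hcc hac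
    have := hc hv hw ha hcc hac
    show Phi p b _ ∈ K
    have e : Phi p b (a • v + c • w) = a • Phi p b v + c • Phi p b w := by
      simp only [Phi, Prod.fst_add, Prod.snd_add, Prod.smul_fst, Prod.smul_snd, smul_eq_mul]
      obtain rfl : a = 1 - c := by linarith
      module
    rw [e]; exact this
  have hdp : ∀ v ∈ T, v.1 ^ 2 + v.2 ^ 2 ≤ l ^ 2 ∧ (l - v.1) ^ 2 + v.2 ^ 2 ≤ l ^ 2 := by
    intro v hv
    have hv' : Phi p b v ∈ closure K := subset_closure hv
    have h1 := Metric.dist_le_diam_of_mem hb.closure hv' hp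
    have h2 := Metric.dist_le_diam_of_mem hb.closure hv' hq
    rw [Metric.diam_closure, ← hldef] at h1 h2
    have h3 := Phi_dist p b v (0,0)
    have h4 := Phi_dist p b v (l,0)
    rw [hP0] at h3
    rw [hPl] at h4
    have h5 := pow_le_pow_left₀ dist_nonneg h1 2
    have h6 := pow_le_pow_left₀ dist_nonneg h2 2
    rw [h3] at h5; rw [h4] at h6
    simp only [sub_zero] at h5 h6
    exact ⟨h5, by nlinarith⟩
  have hfst : ∀ v ∈ T, v.1 ∈ Set.Ioo 0 l := by
    have : T ⊆ Set.Icc 0 l ×ˢ Set.univ := by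
      intro v hv
      obtain ⟨h1, h2⟩ := hdp v hv
      refine ⟨⟨?_, ?_⟩, trivial⟩
      · by_contra hcon
        push Not at hcon
        nlinarith [sq_nonneg v.2]
      · nlinarith [sq_nonneg v.2]
    have h2 := interior_maximal this hTo
    rw [interior_prod_eq, interior_Icc] at h2
    intro v hv; exact (h2 hv).1
  have hsnd : ∀ v ∈ T, v.2 ∈ Set.Icc (-l) l := by
    intro v hv
    obtain ⟨h1, h2⟩ := hdp v hv
    exact abs_le.1 (abs_le_of_sq_le_sq (by nlinarith [sq_nonneg v.1]) hl.le)
  have hne : ∀ x ∈ Set.Ioo 0 l, ∃ y, (x, y) ∈ T := by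
    intro x hx
    have n1 : ∃ v ∈ T, v.1 ≤ x := by
      obtain ⟨z, hz, hzd⟩ := Metric.mem_closure_iff.1 hp x hx.1
      refine ⟨(inner ℝ (b 0) (z - p), inner ℝ (b 1) (z - p)), by rw [hTdef, Set.mem_preimage, Phi_surj]; exact hz, ?_⟩
      simp only
      rw [hb0]
      calc inner ℝ e (z - p) ≤ ‖e‖ * ‖z - p‖ := real_inner_le_norm _ _
        _ ≤ x := by rw [he, one_mul, ← dist_eq_norm, dist_comm]; exact hzd.le
    have n2 : ∃ v ∈ T, x ≤ v.1 := by
      obtain ⟨z, hz, hzd⟩ := Metric.mem_closure_iff.1 hq (l - x) (by linarith [hx.2])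
      refine ⟨(inner ℝ (b 0) (z - p), inner ℝ (b 1) (z - p)), by rw [hTdef, Set.mem_preimage, Phi_surj]; exact hz, ?_⟩
      simp only
      rw [hb0]
      have : inner ℝ e (z - p) = l - inner ℝ e (q - z) := by
        have h1 : z - p = l • e - (q - z) := by rw [hq']; abel
        rw [h1, inner_sub_right, inner_smul_right, real_inner_self_eq_norm_sq, he]; ring
      have h3 : inner ℝ e (q - z) ≤ ‖e‖ * ‖q - z‖ := real_inner_le_norm _ _
      rw [he, one_mul, ← dist_eq_norm] at h3
      linarith
    obtain ⟨v, hv, hvx⟩ := n1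
    obtain ⟨w, hw, hwx⟩ := n2
    have himg : Convex ℝ (Prod.fst '' T) := hTc.linear_image (LinearMap.fst ℝ ℝ ℝ)
    have : x ∈ Prod.fst '' T := himg.ordConnected.out ⟨v, hv, rfl⟩ ⟨w, hw, rfl⟩ ⟨hvx, hwx⟩
    obtain ⟨⟨x', y⟩, hy, rfl⟩ := this
    exact ⟨y, hy⟩
  obtain ⟨f1, f2, f3, f4⟩ := slice_facts hTo hTc (fun v hv => ⟨hfst v hv, hsnd v hv⟩) hne
  have hcoord : ∀ z ∈ K, (inner ℝ (b 0) (z - p), inner ℝ (b 1) (z - p)) ∈ T := fun z hz => by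
    rw [hTdef, Set.mem_preimage, Phi_surj]; exact hz
  refine ⟨p, e, slh T, 2 * |l|, he, f1, f2, f3, ?_, ?_, ?_, ?_⟩
  · intro g hg
    rw [← f4 g hg, setIntegral_Phi p b K]
    congr 1
    funext v
    rw [← hb0, (Phi_coord p b v).1]
  · intro z hz
    have := hfst _ (hcoord z hz)
    simpa [hb0] using this
  · intro x hx
    have h1 := hc.closure hp hq (show 0 ≤ 1 - x / l by rw [sub_nonneg, div_le_one hl]; exact hx.2) (show 0 ≤ x / l by
      exact div_nonneg hx.1 hl.le) (by ring)
    have h2 : (1 - x / l) • p + (x / l) • q = p + x • e := by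
      rw [hq', smul_add, smul_smul, div_mul_cancel₀ _ hl.ne']; module
    rwa [h2] at h1
  · intro δ hδ hno z hz
    set v : ℝ × ℝ := (inner ℝ (b 0) (z - p), inner ℝ (b 1) (z - p)) with hv
    have hzv : Phi p b v = z := Phi_surj p b z
    have hvT : v ∈ T := hcoord z hz
    have hd : dist z (p + (inner ℝ e (z - p)) • e) = |v.2| := by
      have h1 : p + (inner ℝ e (z - p)) • e = Phi p b (v.1, 0) := by simp [Phi, hb0, hv]
      have h2 := Phi_dist p b v (v.1, 0)
      rw [hzv, ← h1] at h2
      simp only [sub_self, sub_zero] at h2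
      rw [← abs_of_nonneg (dist_nonneg (x := z) (y := p + (inner ℝ e (z - p)) • e)), ← sq_eq_sq_iff_abs_eq_abs, h2]; ring
    rw [hd]
    by_contra hcon
    push Not at hcon
    apply hno (Phi p b ((l + v.1) / 3, v.2 / 3))
    have hv2 : v.2 ≠ 0 := by
      intro h0; rw [h0, abs_zero] at hcon; linarith
    have hav2 : 0 < |v.2| := abs_pos.2 hv2
    have hwl : |v.2| ≤ l := abs_le.2 (hsnd v hvT)
    have hv1 := hfst v hvT
    have hsubcl : Metric.ball (Phi p b ((l + v.1) / 3, v.2 / 3)) δ ⊆ closure K := by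
      intro y hy
      set w : ℝ × ℝ := (inner ℝ (b 0) (y - p), inner ℝ (b 1) (y - p)) with hw
      have hyw : Phi p b w = y := Phi_surj p b y
      have h2 := Phi_dist p b w ((l + v.1) / 3, v.2 / 3)
      rw [hyw] at h2
      simp only at h2
      rw [Metric.mem_ball] at hy
      have h3 := pow_lt_pow_left₀ hy dist_nonneg (two_ne_zero)
      rw [h2] at h3
      set s := w.1 - (l + v.1) / 3 with hs
      set t := w.2 - v.2 / 3 with ht
      have hsb : |s| ≤ |v.2| / 6 := (abs_le_of_sq_le_sq (by nlinarith [sq_nonneg t]) hδ.le : |s| ≤ δ).trans (by linarith)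
      have htb : |t| ≤ |v.2| / 6 := (abs_le_of_sq_le_sq (by nlinarith [sq_nonneg s]) hδ.le : |t| ≤ δ).trans (by linarith)
      have h4 : |t / v.2| ≤ 1 / 6 := by
        rw [abs_div, div_le_iff₀ hav2]; linarith
      have h5 : |s / l| ≤ 1 / 6 := by
        rw [abs_div, abs_of_pos hl, div_le_iff₀ hl]; linarith
      rw [abs_le] at h4 h5
      set τ := t / v.2 with hτ
      set σ := s / l with hσ
      set ρ := v.1 / l with hρ
      have hρ0 : 0 ≤ ρ := div_nonneg hv1.1.le hl.le
      have hρ1 : ρ ≤ 1 := by rw [hρ, div_le_one hl]; exact hv1.2.le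
      obtain ⟨ps1, ps2⟩ := prod_small h4.1 h4.2 hρ0 hρ1
      have := comb3 hc.closure hp hq (subset_closure hz) (a := 1/3 - σ - τ * (1 - ρ)) (b := 1/3 + σ - τ * ρ) (c := 1/3 + τ)
        (by linarith [h5.2]) (by linarith [h5.1]) (by linarith [h4.1]) (by ring)
      convert this using 1
      rw [← hyw, ← hzv, hq']
      have ew1 : w.1 = (1/3 + σ - τ * ρ) * l + (1/3 + τ) * v.1 := by
        have a1 : σ * l = s := div_mul_cancel₀ _ hl.ne'
        have a2 : ρ * l = v.1 := div_mul_cancel₀ _ hl.ne'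
        rw [hs] at a1
        linear_combination (-1) * a1 + τ * a2
      have ew2 : w.2 = (1/3 + τ) * v.2 := by
        have a1 : τ * v.2 = t := div_mul_cancel₀ _ hv2
        rw [ht] at a1
        linear_combination (-1) * a1
      simp only [Phi, hb0]
      rw [ew1, ew2]
      module
    have := interior_maximal hsubcl Metric.isOpen_ball
    rwa [hc.interior_closure_eq_interior_of_nonempty_interior (by rwa [ho.interior_eq]), ho.interior_eq] at this

def nvec (θ : ℝ) : Euc 2 := !₂[cos θ, sin θ]

lemma nvec_cont : Continuous nvec := by
  unfold nvec
  refine (PiLp.continuous_toLp 2 _).comp ?_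
  refine continuous_pi fun i => ?_
  fin_cases i
  · exact continuous_cos
  · exact continuous_sin

lemma nvec_norm (θ : ℝ) : inner ℝ (nvec θ) (nvec θ) = (1:ℝ) := by
  rw [PiLp.inner_apply, Fin.sum_univ_two]
  simp only [nvec]
  simp

lemma nvec_pi (θ : ℝ) : nvec (θ + π) = - nvec θ := by
  ext i; fin_cases i <;> simp [nvec]

lemma line_null (n z : Euc 2) (hn : inner ℝ n n = (1:ℝ)) : volume {y : Euc 2 | inner ℝ n (y - z) = (0:ℝ)} = 0 := by
  let A : AffineSubspace ℝ (Euc 2) := AffineSubspace.mk' z (LinearMap.ker (innerSL ℝ n).toLinearMap)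
  have hA : A ≠ ⊤ := by
    intro h
    have : z + n ∈ A := by rw [h]; trivial
    rw [AffineSubspace.mem_mk'] at this
    simp at this
    rw [this] at hn; simp at hn
  have := Measure.addHaar_affineSubspace volume A hA
  refine measure_mono_null ?_ this
  intro y hy
  show y ∈ A
  rw [AffineSubspace.mem_mk']
  simpa using hy

def HP (n z : Euc 2) : Set (Euc 2) := {y | 0 < inner ℝ n (y - z)}

lemma HP_open (n z : Euc 2) : IsOpen (HP n z) := isOpen_lt continuous_const (by fun_prop)
lemma HP_convex (n z : Euc 2) : Convex ℝ (HP n z) := by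
  intro x hx y hy a b ha hb hab
  simp only [HP, Set.mem_ofPred_eq] at *
  have e : a • x + b • y - z = a • (x - z) + b • (y - z) := by
    obtain rfl : a = 1 - b := by linarith
    module
  rw [e, inner_add_right, inner_smul_right, inner_smul_right]
  rcases eq_or_lt_of_le ha with h0 | h0
  · subst h0
    have : b = 1 := by linarith
    subst this; simpa using hy
  · have := mul_pos h0 hx
    have := mul_nonneg hb hy.le
    linarith

lemma int_on {K : Set (Euc 2)} (hb : Bornology.IsBounded K) {u : Euc 2 → ℝ} (hu : Continuous u) : IntegrableOn u K :=
  (hu.continuousOn.integrableOn_compact hb.isCompact_closure).mono_set subset_closure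

lemma split_half {K : Set (Euc 2)} (ho : IsOpen K) (hb : Bornology.IsBounded K) {u : Euc 2 → ℝ} (hu : Continuous u)
    (n z : Euc 2) (hn : inner ℝ n n = (1:ℝ)) :
    ∫ y in K, u y = (∫ y in K ∩ HP n z, u y) + ∫ y in K ∩ HP (-n) z, u y := by
  have hd : Disjoint (K ∩ HP n z) (K ∩ HP (-n) z) := by
    rw [Set.disjoint_left]
    rintro y ⟨_, h1⟩ ⟨_, h2⟩
    simp only [HP, Set.mem_ofPred_eq, inner_neg_left] at h1 h2
    linarith
  rw [← setIntegral_union hd (ho.inter (HP_open _ _)).measurableSet ((int_on hb hu).mono_set Set.inter_subset_left)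
    ((int_on hb hu).mono_set Set.inter_subset_left)]
  apply setIntegral_congr_set
  rw [← Set.inter_union_distrib_left]
  have : ∀ᵐ y : Euc 2, inner ℝ n (y - z) ≠ (0:ℝ) := by
    rw [ae_iff]; simpa using line_null n z hn
  filter_upwards [this] with y hy
  apply propext
  constructor
  · intro hK
    refine ⟨hK, ?_⟩
    rcases lt_or_gt_of_ne hy with h | h
    · right; simp only [HP, Set.mem_ofPred_eq, inner_neg_left]; linarith
    · left; exact h
  · intro h; exact h.1

lemma half_cont {K : Set (Euc 2)} (ho : IsOpen K) (hb : Bornology.IsBounded K) {u : Euc 2 → ℝ} (hu : Continuous u)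
    (z : Euc 2) : Continuous (fun θ => ∫ y in K ∩ HP (nvec θ) z, u y) := by
  have e : (fun θ => ∫ y in K ∩ HP (nvec θ) z, u y) = fun θ => ∫ y in K, (HP (nvec θ) z).indicator u y := by
    funext θ
    rw [setIntegral_indicator (HP_open _ _).measurableSet]
  rw [e, continuous_iff_continuousAt]
  intro θ₀
  apply continuousAt_of_dominated (bound := fun y => ‖u y‖)
  · exact Eventually.of_forall fun θ => (hu.aestronglyMeasurable.indicator (HP_open _ _).measurableSet)
  · exact Eventually.of_forall fun θ => Eventually.of_forall fun y => norm_indicator_le_norm_self _ _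
  · exact (int_on hb hu).norm
  · have : ∀ᵐ y : Euc 2, inner ℝ (nvec θ₀) (y - z) ≠ (0:ℝ) := by
      rw [ae_iff]; simpa using line_null _ z (nvec_norm θ₀)
    filter_upwards [ae_restrict_of_ae this] with y hy
    have hcont : Continuous fun θ => inner ℝ (nvec θ) (y - z) := nvec_cont.inner continuous_const
    rcases lt_or_gt_of_ne hy with h | h
    · have hev : ∀ᶠ θ in 𝓝 θ₀, inner ℝ (nvec θ) (y - z) < 0 := hcont.continuousAt.eventually_lt_const h
      have : (fun θ => (HP (nvec θ) z).indicator u y) =ᶠ[𝓝 θ₀] fun _ => 0 := by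
        filter_upwards [hev] with θ hθ
        apply Set.indicator_of_notMem
        simp only [HP, Set.mem_ofPred_eq]; linarith
      exact continuousAt_const.congr this.symm
    · have hev : ∀ᶠ θ in 𝓝 θ₀, 0 < inner ℝ (nvec θ) (y - z) := hcont.continuousAt.eventually_const_lt h
      have : (fun θ => (HP (nvec θ) z).indicator u y) =ᶠ[𝓝 θ₀] fun _ => u y := by
        filter_upwards [hev] with θ hθ
        apply Set.indicator_of_mem
        exact hθ
      exact continuousAt_const.congr this.symm

lemma cut {K : Set (Euc 2)} (ho : IsOpen K) (hb : Bornology.IsBounded K) (hc : Convex ℝ K) {u g : Euc 2 → ℝ}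
    (hu : Continuous u) (hg : Continuous g) (h0 : ∫ y in K, u y = 0) (hneg : ∫ y in K, g y < 0) (z : Euc 2) :
    ∃ K' ⊆ K, IsOpen K' ∧ Convex ℝ K' ∧ z ∉ K' ∧ ∫ y in K', u y = 0 ∧ ∫ y in K', g y < 0 := by
  set F := fun θ => ∫ y in K ∩ HP (nvec θ) z, u y with hF
  have hFc : Continuous F := half_cont ho hb hu z
  have hsum : ∀ θ, F θ + F (θ + π) = 0 := by
    intro θ
    have := split_half ho hb hu (nvec θ) z (nvec_norm θ)
    rw [h0, ← nvec_pi] at this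
    exact this.symm
  have hex : ∃ θ, F θ = 0 := by
    have h1 := hsum 0
    rw [zero_add] at h1
    rcases le_total (F 0) 0 with h | h
    · have := intermediate_value_Icc pi_pos.le (hFc.continuousOn) (show (0:ℝ) ∈ Set.Icc (F 0) (F π) from ⟨h, by linarith⟩)
      obtain ⟨θ, _, hθ⟩ := this; exact ⟨θ, hθ⟩
    · have := intermediate_value_Icc' pi_pos.le (hFc.continuousOn) (show (0:ℝ) ∈ Set.Icc (F π) (F 0) from ⟨by linarith, h⟩)
      obtain ⟨θ, _, hθ⟩ := this; exact ⟨θ, hθ⟩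
  obtain ⟨θ, hθ⟩ := hex
  have hθ' : F (θ + π) = 0 := by linarith [hsum θ]
  have hz : ∀ n, z ∉ K ∩ HP n z := by
    intro n h; have := h.2; simp [HP] at this
  have hs := split_half ho hb hg (nvec θ) z (nvec_norm θ)
  rw [← nvec_pi] at hs
  rcases lt_or_ge (∫ y in K ∩ HP (nvec θ) z, g y) 0 with h | h
  · exact ⟨_, Set.inter_subset_left, ho.inter (HP_open _ _), hc.inter (HP_convex _ _), hz _, hθ, h⟩
  · exact ⟨_, Set.inter_subset_left, ho.inter (HP_open _ _), hc.inter (HP_convex _ _), hz _, hθ', by linarith⟩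

lemma cut_finset {K : Set (Euc 2)} (ho : IsOpen K) (hb : Bornology.IsBounded K) (hc : Convex ℝ K) {u g : Euc 2 → ℝ}
    (hu : Continuous u) (hg : Continuous g) (h0 : ∫ y in K, u y = 0) (hneg : ∫ y in K, g y < 0) (S : Finset (Euc 2)) :
    ∃ K' ⊆ K, IsOpen K' ∧ Convex ℝ K' ∧ (∀ z ∈ S, z ∉ K') ∧ ∫ y in K', u y = 0 ∧ ∫ y in K', g y < 0 := by
  classical
  induction S using Finset.induction_on with
  | empty => exact ⟨K, subset_rfl, ho, hc, by simp, h0, hneg⟩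
  | insert a S ha ih =>
    obtain ⟨K1, h1, h2, h3, h4, h5, h6⟩ := ih
    obtain ⟨K2, g1, g2, g3, g4, g5, g6⟩ := cut h2 (hb.subset h1) h3 hu hg h5 h6 a
    refine ⟨K2, g1.trans h1, g2, g3, ?_, g5, g6⟩
    intro z hz
    rcases Finset.mem_insert.1 hz with rfl | hz
    · exact g4
    · exact fun h => h4 z hz (g1 h)

lemma cut_thin {K : Set (Euc 2)} (ho : IsOpen K) (hb : Bornology.IsBounded K) (hc : Convex ℝ K) {u g : Euc 2 → ℝ}
    (hu : Continuous u) (hg : Continuous g) (h0 : ∫ y in K, u y = 0) (hneg : ∫ y in K, g y < 0) {δ : ℝ} (hδ : 0 < δ) :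
    ∃ K' ⊆ K, IsConvexDomain K' ∧ (∀ c, ¬ Metric.ball c δ ⊆ K') ∧ ∫ y in K', u y = 0 ∧ ∫ y in K', g y < 0 := by
  have htb : TotallyBounded K := (hb.isCompact_closure.totallyBounded).subset subset_closure
  obtain ⟨S, hSf, hS⟩ := Metric.totallyBounded_iff.1 htb δ hδ
  obtain ⟨K', h1, h2, h3, h4, h5, h6⟩ := cut_finset ho hb hc hu hg h0 hneg hSf.toFinset
  refine ⟨K', h1, ⟨?_, h2, hb.subset h1, h3⟩, ?_, h5, h6⟩
  · by_contra hne
    rw [Set.not_nonempty_iff_eq_empty] at hne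
    rw [hne] at h6; simp at h6
  · intro c hball
    have hcK : c ∈ K := h1 (hball (Metric.mem_ball_self hδ))
    have := hS hcK
    simp only [Set.mem_iUnion] at this
    obtain ⟨y, hy, hcy⟩ := this
    refine h4 y (by simpa using hy) (hball ?_)
    rw [Metric.mem_ball, dist_comm]; exact hcy

lemma uc_aux {C : Set (Euc 2)} (hC : IsCompact C) {F : Euc 2 → ℝ} (hF : Continuous F) {η : ℝ} (hη : 0 < η) :
    ∃ d > 0, ∀ z ∈ C, ∀ w ∈ C, dist z w < d → |F z - F w| ≤ η := by
  have := Metric.uniformContinuousOn_iff.1 (hC.uniformContinuousOn_of_continuous hF.continuousOn) η hη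
  obtain ⟨d, hd, h⟩ := this
  exact ⟨d, hd, fun z hz w hw hzw => (h z hz w hw hzw).le⟩

lemma fd_cont {u : Euc 2 → ℝ} (hu : ContDiff ℝ (⊤ : ℕ∞) u) : Continuous (fun z => fderiv ℝ u z) :=
  hu.continuous_fderiv (by simp)

lemma comp_bound {K : Set (Euc 2)} (ho : IsOpen K) (hb : Bornology.IsBounded K) {F G : Euc 2 → ℝ} (hF : Continuous F) (hG : Continuous G)
    {η : ℝ} (h : ∀ z ∈ K, F z ≤ G z + η) : ∫ z in K, F z ≤ (∫ z in K, G z) + η * volume.real K := by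
  have h1 : ∫ z in K, F z ≤ ∫ z in K, (G z + η) :=
    setIntegral_mono_on (int_on hb hF) (int_on hb (by fun_prop)) ho.measurableSet h
  rw [integral_add (int_on hb hG) (int_on hb continuous_const), setIntegral_const, smul_eq_mul, mul_comm (volume.real K)] at h1
  exact h1

set_option maxHeartbeats 1000000 in
theorem payne_weinberger {Ω : Set (Euc 2)} (hΩ : IsConvexDomain Ω) {u : Euc 2 → ℝ} (hu : ContDiff ℝ (⊤ : ℕ∞) u)
    (h0 : ∫ z in Ω, u z = 0) :
    (π / Metric.diam Ω) ^ 2 * ∫ z in Ω, u z ^ 2 ≤ ∫ z in Ω, ‖fderiv ℝ u z‖ ^ 2 := by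
  have hD := diam_pos' hΩ
  obtain ⟨hn, ho, hb, hc⟩ := hΩ
  by_contra hcon
  push Not at hcon
  have huc : Continuous u := hu.continuous
  have hfc := fd_cont hu
  set D := Metric.diam Ω with hDdef
  set lam := (π / D) ^ 2 with hlam
  have hlam0 : 0 < lam := by positivity
  have hV : 0 < volume.real Ω := ENNReal.toReal_pos (ho.measure_pos volume hn).ne' hb.measure_lt_top.ne
  set gap := lam * (∫ z in Ω, u z ^ 2) - ∫ z in Ω, ‖fderiv ℝ u z‖ ^ 2 with hgap
  have hgap0 : 0 < gap := by linarith
  set ε := gap / (2 * volume.real Ω) with hε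
  have hε0 : 0 < ε := by positivity
  have hGc : Continuous fun z => ‖fderiv ℝ u z‖ ^ 2 := by fun_prop
  have hu2c : Continuous fun z => u z ^ 2 := by fun_prop
  let g : Euc 2 → ℝ := fun z => ‖fderiv ℝ u z‖ ^ 2 - lam * u z ^ 2 + ε
  have hgc : Continuous g := by simp only [g]; fun_prop
  have hgint : ∀ K : Set (Euc 2), Bornology.IsBounded K → ∫ z in K, g z =
      (∫ z in K, ‖fderiv ℝ u z‖ ^ 2) - lam * (∫ z in K, u z ^ 2) + ε * volume.real K := by
    intro K hK
    simp only [g]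
    have hl2 : Continuous fun z => lam * u z ^ 2 := by fun_prop
    have hl3 : Continuous fun z => ‖fderiv ℝ u z‖ ^ 2 - lam * u z ^ 2 := hGc.sub hl2
    rw [integral_add (int_on hK hl3) (int_on hK continuous_const),
      integral_sub (int_on hK hGc) (int_on hK hl2), integral_const_mul, setIntegral_const, smul_eq_mul, mul_comm (volume.real K)]
  have hneg : ∫ z in Ω, g z < 0 := by
    rw [hgint Ω hb]
    have : ε * volume.real Ω = gap / 2 := by rw [hε]; field_simp
    rw [this]; linarith
  set η := min 1 (ε / (1 + 2 * lam)) with hη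
  have hη0 : 0 < η := lt_min one_pos (by positivity)
  have hη1 : η ≤ 1 := min_le_left _ _
  have hη2 : η * (1 + 2 * lam) ≤ ε := by
    have : η ≤ ε / (1 + 2 * lam) := min_le_right _ _
    rwa [le_div_iff₀ (by positivity)] at this
  have hC := hb.isCompact_closure
  obtain ⟨d1, hd1, H1⟩ := uc_aux hC huc hη0
  obtain ⟨d2, hd2, H2⟩ := uc_aux hC hu2c hη0
  obtain ⟨d3, hd3, H3⟩ := uc_aux hC hGc hη0
  set d := min d1 (min d2 d3) with hd
  have hd0 : 0 < d := lt_min hd1 (lt_min hd2 hd3)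
  have hdd1 : d ≤ d1 := min_le_left _ _
  have hdd2 : d ≤ d2 := (min_le_right _ _).trans (min_le_left _ _)
  have hdd3 : d ≤ d3 := (min_le_right _ _).trans (min_le_right _ _)
  obtain ⟨K, hKΩ, hKd, hthin, hK0, hKneg⟩ := cut_thin ho hb hc huc hgc h0 hneg (show 0 < d / 7 by positivity)
  obtain ⟨p, e, h, M, he, hconc, hpos, hM, hfub, hcoord, hcl, hth⟩ := exists_frame hKd
  have hl := diam_pos' hKd
  have hth' := hth (d/7) (by positivity) hthin
  obtain ⟨hKn, hKo, hKb, hKc⟩ := hKd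
  set l := Metric.diam K with hldef
  have hlD : l ≤ D := Metric.diam_mono hKΩ hb
  have hVK : 0 < volume.real K := ENNReal.toReal_pos (hKo.measure_pos volume hKn).ne' hKb.measure_lt_top.ne
  have hpt : ∀ z ∈ K, z ∈ closure Ω ∧ p + (inner ℝ e (z - p)) • e ∈ closure Ω ∧ dist z (p + (inner ℝ e (z - p)) • e) < d := by
    intro z hz
    refine ⟨subset_closure (hKΩ hz), closure_mono hKΩ (hcl _ ⟨(hcoord z hz).1.le, (hcoord z hz).2.le⟩), ?_⟩
    exact (hth' z hz).trans_lt (by linarith)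
  set f : ℝ → ℝ := fun x => u (p + x • e) with hf
  set f' : ℝ → ℝ := fun x => fderiv ℝ u (p + x • e) e with hf'
  have hfd : ∀ x, HasDerivAt f (f' x) x := by
    intro x
    have h1 : HasDerivAt (fun x : ℝ => p + x • e) e x := by
      simpa using ((hasDerivAt_id x).smul_const e).const_add p
    exact ((hu.differentiable (by simp)) (p + x • e)).hasFDerivAt.comp_hasDerivAt x h1
  have hfcn : Continuous f := by simp only [hf]; fun_prop
  have hf'c : Continuous f' := by
    have : Continuous fun x : ℝ => fderiv ℝ u (p + x • e) := hfc.comp (by fun_prop)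
    exact this.clm_apply continuous_const
  have hpoin := concave_poincare hl hconc hpos (fun x _ => hM x) hfd hf'c
  have hcx : Continuous fun z : Euc 2 => (inner ℝ e (z - p) : ℝ) := by fun_prop
  have hx2 : Continuous fun z : Euc 2 => f (inner ℝ e (z - p)) ^ 2 := by fun_prop
  have hx3 : Continuous fun z : Euc 2 => f' (inner ℝ e (z - p)) ^ 2 := by fun_prop
  rw [← hfub (fun x => f x ^ 2) (by fun_prop), ← hfub (fun x => f x) hfcn, ← hfub (fun x => f' x ^ 2) (by fun_prop),
    ← hfub (fun x => 1) (by fun_prop)] at hpoin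
  rw [setIntegral_const, smul_eq_mul, mul_one] at hpoin
  set I2 := ∫ z in K, f (inner ℝ e (z - p)) ^ 2 with hI2
  set I1 := ∫ z in K, f (inner ℝ e (z - p)) with hI1
  set E := ∫ z in K, f' (inner ℝ e (z - p)) ^ 2 with hE
  set v := volume.real K with hv
  have b1 : ∫ z in K, u z ^ 2 ≤ I2 + η * v := by
    refine comp_bound hKo hKb hu2c hx2 ?_
    intro z hz
    obtain ⟨q1, q2, q3⟩ := hpt z hz
    have := (abs_le.1 (H2 z q1 _ q2 (q3.trans_le hdd2))).2
    show _
    simp only [hf, Function.comp]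
    linarith
  have b2 : I1 ≤ 0 + η * v := by
    rw [← hK0]
    refine comp_bound hKo hKb (hfcn.comp hcx) huc ?_
    intro z hz
    obtain ⟨q1, q2, q3⟩ := hpt z hz
    have := (abs_le.1 (H1 z q1 _ q2 (q3.trans_le hdd1))).1
    show _
    simp only [hf, Function.comp]
    linarith
  have b3 : 0 ≤ I1 + η * v := by
    rw [← hK0]
    refine comp_bound hKo hKb huc (hfcn.comp hcx) ?_
    intro z hz
    obtain ⟨q1, q2, q3⟩ := hpt z hz
    have := (abs_le.1 (H1 z q1 _ q2 (q3.trans_le hdd1))).2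
    show _
    simp only [hf, Function.comp]
    linarith
  have b4 : E ≤ (∫ z in K, ‖fderiv ℝ u z‖ ^ 2) + η * v := by
    refine comp_bound hKo hKb hx3 hGc ?_
    intro z hz
    obtain ⟨q1, q2, q3⟩ := hpt z hz
    have := (abs_le.1 (H3 z q1 _ q2 (q3.trans_le hdd3))).1
    have h5 : f' (inner ℝ e (z - p)) ^ 2 ≤ ‖fderiv ℝ u (p + (inner ℝ e (z - p)) • e)‖ ^ 2 := by
      rw [← sq_abs]
      apply pow_le_pow_left₀ (abs_nonneg _)
      have := (fderiv ℝ u (p + (inner ℝ e (z - p) : ℝ) • e)).le_opNorm e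
      rw [he, mul_one] at this
      exact this
    linarith
  have hE0 : 0 ≤ E := integral_nonneg (fun z => sq_nonneg _)
  have key : lam * (I2 * v - I1 ^ 2) ≤ E * v := by
    rcases le_total 0 (I2 * v - I1 ^ 2) with hs | hs
    · refine le_trans (mul_le_mul_of_nonneg_right ?_ hs) hpoin
      apply pow_le_pow_left₀ (by positivity)
      exact div_le_div_of_nonneg_left pi_pos.le hl hlD
    · exact (mul_nonpos_of_nonneg_of_nonpos hlam0.le hs).trans (by positivity)
  have hI1sq : I1 ^ 2 ≤ (η * v) ^ 2 := by
    apply sq_le_sq' <;> linarith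
  have key2 : lam * (I2 - η ^ 2 * v) ≤ E := by
    have : lam * (I2 - η ^ 2 * v) * v ≤ E * v := by
      have := mul_le_mul_of_nonneg_left hI1sq hlam0.le
      nlinarith
    exact le_of_mul_le_mul_right this hVK
  rw [hgint K hKb] at hKneg
  have k1 := mul_le_mul_of_nonneg_left b1 hlam0.le
  have hη3 : η ^ 2 ≤ η := by nlinarith
  have k2 := mul_le_mul_of_nonneg_right (mul_le_mul_of_nonneg_left hη3 hlam0.le) hVK.le
  have k3 := mul_le_mul_of_nonneg_right hη2 hVK.le
  nlinarith

lemma sq_int_pos {Ω : Set (Euc 2)} (ho : IsOpen Ω) (hb : Bornology.IsBounded Ω) {u : Euc 2 → ℝ} (hu : Continuous u)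
    {z : Euc 2} (hz : z ∈ Ω) (hne : u z ≠ 0) : 0 < ∫ x in Ω, u x ^ 2 := by
  rw [setIntegral_pos_iff_support_of_nonneg_ae (Eventually.of_forall fun x => sq_nonneg (u x)) (int_on hb (by fun_prop))]
  have hs : IsOpen (Function.support (fun x => u x ^ 2) ∩ Ω) := (isOpen_ne_fun (by fun_prop) continuous_const).inter ho
  exact hs.measure_pos volume ⟨z, by simpa using hne, hz⟩

abbrev Rst (Ω : Set (Euc 2)) := LinearMap.funLeft ℝ ℝ ((↑) : Ω → Euc 2)

lemma basis_lift {Ω : Set (Euc 2)} {k : ℕ} {V : Submodule ℝ (Euc 2 → ℝ)}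
    (hV : Module.finrank ℝ (V.map (Rst Ω)) = k + 1) :
    ∃ U : Fin (k+1) → (Euc 2 → ℝ), (∀ i, U i ∈ V) ∧
      (∀ c : Fin (k+1) → ℝ, (∀ z ∈ Ω, (∑ i, c i * U i z) = 0) → c = 0) ∧
      (∀ u ∈ V, ∃ c : Fin (k+1) → ℝ, ∀ z ∈ Ω, u z = ∑ i, c i * U i z) := by
  have hfin : Module.Finite ℝ (V.map (Rst Ω)) := Module.finite_of_finrank_pos (by rw [hV]; omega)
  let b := Module.finBasisOfFinrankEq ℝ (V.map (Rst Ω)) hV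
  have h1 : ∀ i, ∃ u ∈ V, Rst Ω u = (b i : Ω → ℝ) := fun i => (b i).2
  choose U hU hUb using h1
  have hval : ∀ i, ∀ z : Ω, (b i : Ω → ℝ) z = U i z := fun i z => by rw [← hUb i]; rfl
  refine ⟨U, hU, ?_, ?_⟩
  · intro c hc
    have := b.linearIndependent
    rw [Fintype.linearIndependent_iff] at this
    funext i
    refine this c ?_ i
    apply Subtype.ext
    funext z
    rw [Submodule.coe_sum, Finset.sum_apply]
    simp only [Submodule.coe_smul, Pi.smul_apply, smul_eq_mul, hval]
    exact hc z z.2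
  · intro u hu
    let w : V.map (Rst Ω) := ⟨Rst Ω u, u, hu, rfl⟩
    refine ⟨fun i => b.repr w i, ?_⟩
    intro z hz
    have h2 := b.sum_repr w
    have h3 := congrFun (congrArg Subtype.val h2) ⟨z, hz⟩
    rw [Submodule.coe_sum, Finset.sum_apply] at h3
    simp only [Submodule.coe_smul, Pi.smul_apply, smul_eq_mul, hval] at h3
    exact h3.symm

lemma rayleigh_bdd {Ω : Set (Euc 2)} (hΩ : IsConvexDomain Ω) {k : ℕ} {V : Submodule ℝ (Euc 2 → ℝ)}
    (hsm : ∀ u ∈ V, ContDiff ℝ (⊤ : ℕ∞) u)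
    (hV : Module.finrank ℝ (V.map (Rst Ω)) = k + 1) :
    BddAbove { r : ℝ | ∃ u ∈ V, (0 < ∫ x in Ω, (u x) ^ 2) ∧ r = rayleigh Ω u } := by
  obtain ⟨hn, ho, hb, hc⟩ := hΩ
  obtain ⟨U, hU, hind, hspan⟩ := basis_lift hV
  have hUc : ∀ i, Continuous (U i) := fun i => (hsm _ (hU i)).continuous
  have hUd : ∀ i, Differentiable ℝ (U i) := fun i => (hsm _ (hU i)).differentiable (by simp)
  have hfc : ∀ i, Continuous fun z => fderiv ℝ (U i) z := fun i => fd_cont (hsm _ (hU i))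
  let q : EuclideanSpace ℝ (Fin (k+1)) → ℝ := fun c => ∑ i, ∑ j, c i * c j * ∫ z in Ω, U i z * U j z
  have hqc : Continuous q := by
    simp only [q]; fun_prop
  have hq : ∀ c, q c = ∫ z in Ω, (∑ i, c i * U i z) ^ 2 := by
    intro c
    simp only [q]
    have : ∀ z, (∑ i, c i * U i z) ^ 2 = ∑ i, ∑ j, c i * c j * (U i z * U j z) := by
      intro z
      rw [sq, Finset.sum_mul_sum]
      refine Finset.sum_congr rfl fun i _ => Finset.sum_congr rfl fun j _ => by ring
    simp_rw [this]
    rw [integral_finsetSum _ (fun i _ => int_on hb (by have := hUc; fun_prop))]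
    refine Finset.sum_congr rfl fun i _ => ?_
    rw [integral_finsetSum _ (fun j _ => int_on hb (by have := hUc i; have := hUc j; fun_prop))]
    refine Finset.sum_congr rfl fun j _ => ?_
    rw [integral_const_mul]
  have hqpos : ∀ c, c ≠ 0 → 0 < q c := by
    intro c hc0
    rw [hq]
    by_cases hz : ∀ z ∈ Ω, (∑ i, c i * U i z) = 0
    · exfalso; apply hc0
      have := hind (fun i => c i) hz
      ext i; exact congrFun this i
    · push Not at hz
      obtain ⟨z, hz, hne⟩ := hz
      exact sq_int_pos ho hb (u := fun z => ∑ i, c i * U i z) (by have := hUc; fun_prop) hz hne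
  obtain ⟨c0, hc0, hmin⟩ := (isCompact_sphere (0 : EuclideanSpace ℝ (Fin (k+1))) 1).exists_isMinOn
    (NormedSpace.sphere_nonempty.2 zero_le_one) hqc.continuousOn
  set m := q c0 with hm
  have hm0 : 0 < m := hqpos c0 (by
    intro h; rw [h] at hc0; simp at hc0)
  have hhom : ∀ c, m * ‖c‖ ^ 2 ≤ q c := by
    intro c
    by_cases hc : c = 0
    · subst hc; simp [q]
    have hnc : 0 < ‖c‖ := norm_pos_iff.2 hc
    have h1 : (‖c‖⁻¹ • c) ∈ Metric.sphere (0 : EuclideanSpace ℝ (Fin (k+1))) 1 := by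
      rw [mem_sphere_zero_iff_norm, norm_smul, norm_inv, norm_norm, inv_mul_cancel₀ hnc.ne']
    have h2 : m ≤ q (‖c‖⁻¹ • c) := isMinOn_iff.1 hmin _ h1
    have h3 : q (‖c‖⁻¹ • c) = (‖c‖⁻¹)^2 * q c := by
      simp only [q, PiLp.smul_apply, smul_eq_mul, Finset.mul_sum]
      refine Finset.sum_congr rfl fun i _ => Finset.sum_congr rfl fun j _ => by ring
    rw [h3, inv_pow, inv_mul_eq_div, le_div_iff₀ (by positivity)] at h2
    exact h2
  set A := ∫ z in Ω, ∑ i, ‖fderiv ℝ (U i) z‖ ^ 2 with hA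
  refine ⟨A / m, ?_⟩
  rintro r ⟨u, hu, hpos, rfl⟩
  obtain ⟨c', hc'⟩ := hspan u hu
  let c : EuclideanSpace ℝ (Fin (k+1)) := WithLp.toLp 2 c'
  have hcc : ∀ z ∈ Ω, u z = ∑ i, c i * U i z := hc'
  have hq2 : ∫ z in Ω, u z ^ 2 = q c := by
    rw [hq]
    exact setIntegral_congr_fun ho.measurableSet (fun z hz => by simp only; rw [hcc z hz])
  have hE : ∫ z in Ω, ‖fderiv ℝ u z‖ ^ 2 ≤ ‖c‖ ^ 2 * A := by
    rw [hA, ← integral_const_mul]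
    refine setIntegral_mono_on (int_on hb (by have := fd_cont (hsm u hu); fun_prop)) (int_on hb (by have := hfc; fun_prop)) ho.measurableSet ?_
    intro z hz
    have h1 : u =ᶠ[𝓝 z] fun z => ∑ i, c i * U i z := by
      filter_upwards [ho.mem_nhds hz] with y hy using hcc y hy
    have h2 : fderiv ℝ u z = ∑ i, c i • fderiv ℝ (U i) z := by
      rw [h1.fderiv_eq]
      apply HasFDerivAt.fderiv
      exact HasFDerivAt.fun_sum (fun i _ => ((hUd i) z).hasFDerivAt.const_mul (c i))
    rw [h2]
    calc ‖∑ i, c i • fderiv ℝ (U i) z‖ ^ 2 ≤ (∑ i, ‖c i‖ * ‖fderiv ℝ (U i) z‖) ^ 2 := by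
          apply pow_le_pow_left₀ (norm_nonneg _)
          refine (norm_sum_le _ _).trans (Finset.sum_le_sum fun i _ => ?_)
          rw [norm_smul]
      _ ≤ (∑ i, ‖c i‖ ^ 2) * ∑ i, ‖fderiv ℝ (U i) z‖ ^ 2 := Finset.sum_mul_sq_le_sq_mul_sq _ _ _
      _ = ‖c‖ ^ 2 * ∑ i, ‖fderiv ℝ (U i) z‖ ^ 2 := by rw [EuclideanSpace.norm_sq_eq]
  have hA0 : 0 ≤ A := integral_nonneg fun z => Finset.sum_nonneg fun i _ => sq_nonneg _
  unfold rayleigh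
  rw [div_le_div_iff₀ hpos hm0, hq2]
  calc (∫ z in Ω, ‖fderiv ℝ u z‖ ^ 2) * m ≤ ‖c‖ ^ 2 * A * m := mul_le_mul_of_nonneg_right hE hm0.le
    _ = A * (m * ‖c‖ ^ 2) := by ring
    _ ≤ A * q c := mul_le_mul_of_nonneg_left (hhom c) hA0

lemma sup_lower {Ω : Set (Euc 2)} (hΩ : IsConvexDomain Ω) {k : ℕ} (hk : 1 ≤ k) {V : Submodule ℝ (Euc 2 → ℝ)}
    (hsm : ∀ u ∈ V, ContDiff ℝ (⊤ : ℕ∞) u)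
    (hV : Module.finrank ℝ (V.map (Rst Ω)) = k + 1) :
    (π / Metric.diam Ω) ^ 2 ≤ sSup { r : ℝ | ∃ u ∈ V, (0 < ∫ x in Ω, (u x) ^ 2) ∧ r = rayleigh Ω u } := by
  have hbdd := rayleigh_bdd hΩ hsm hV
  obtain ⟨U, hU, hind, hspan⟩ := basis_lift hV
  have hUc : ∀ i, Continuous (U i) := fun i => (hsm _ (hU i)).continuous
  obtain ⟨hn, ho, hb, hc⟩ := id hΩ
  have h01 : (⟨0, by omega⟩ : Fin (k+1)) ≠ ⟨1, by omega⟩ := by simp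
  set i0 : Fin (k+1) := ⟨0, by omega⟩
  set i1 : Fin (k+1) := ⟨1, by omega⟩
  have hex : ∃ a b : ℝ, (a ≠ 0 ∨ b ≠ 0) ∧ a * (∫ z in Ω, U i0 z) + b * (∫ z in Ω, U i1 z) = 0 := by
    by_cases h : ∫ z in Ω, U i1 z = 0
    · exact ⟨0, 1, by simp, by rw [h]; simp⟩
    · exact ⟨∫ z in Ω, U i1 z, -∫ z in Ω, U i0 z, Or.inl h, by ring⟩
  obtain ⟨a, b, hab, hz⟩ := hex
  let u : Euc 2 → ℝ := a • U i0 + b • U i1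
  have hu : u ∈ V := V.add_mem (V.smul_mem _ (hU _)) (V.smul_mem _ (hU _))
  have hux : ∀ z, u z = a * U i0 z + b * U i1 z := fun z => by simp [u]
  have hmean : ∫ z in Ω, u z = 0 := by
    simp_rw [hux]
    have c0 := hUc i0
    have c1 := hUc i1
    rw [integral_add (int_on hb (by fun_prop)) (int_on hb (by fun_prop)), integral_const_mul, integral_const_mul, hz]
  have hne : ∃ z ∈ Ω, u z ≠ 0 := by
    by_contra hcon
    push Not at hcon
    have := hind (fun i => if i = i0 then a else if i = i1 then b else 0) (by
      intro z hz
      have key := hcon z hz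
      rw [hux] at key
      rw [Finset.sum_eq_add i0 i1 h01]
      · simpa [h01.symm] using key
      · rintro i _ ⟨h1, h2⟩; simp [h1, h2]
      · simp
      · simp)
    have e0 := congrFun this i0
    have e1 := congrFun this i1
    simp [h01.symm] at e0 e1
    rcases hab with h | h
    · exact h e0
    · exact h e1
  obtain ⟨z, hzΩ, hzu⟩ := hne
  have hpos := sq_int_pos ho hb (hsm u hu).continuous hzΩ hzu
  refine le_trans ?_ (le_csSup hbdd ⟨u, hu, hpos, rfl⟩)
  unfold rayleigh
  rw [le_div_iff₀ hpos]
  exact payne_weinberger hΩ (hsm u hu) hmean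

def Tst (δ t : ℝ) : ℝ := Real.smoothTransition ((t - δ) / δ)
def Tfn (δ s : ℝ) : ℝ := ∫ t in (0:ℝ)..s, Tst δ t

lemma Tst_contDiff (δ : ℝ) : ContDiff ℝ (⊤ : ℕ∞) (Tst δ) := by
  unfold Tst
  exact Real.smoothTransition.contDiff.comp (by fun_prop)

lemma Tfn_hasDeriv (δ s : ℝ) : HasDerivAt (Tfn δ) (Tst δ s) s := by
  have hc := (Tst_contDiff δ).continuous
  exact intervalIntegral.integral_hasDerivAt_right (hc.intervalIntegrable _ _)
    (hc.stronglyMeasurableAtFilter _ _) hc.continuousAt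

lemma Tfn_contDiff (δ : ℝ) : ContDiff ℝ (⊤ : ℕ∞) (Tfn δ) := by
  rw [contDiff_infty_iff_deriv]
  refine ⟨fun s => (Tfn_hasDeriv δ s).differentiableAt, ?_⟩
  have : deriv (Tfn δ) = Tst δ := funext fun s => (Tfn_hasDeriv δ s).deriv
  rw [this]; exact Tst_contDiff δ

lemma Tst_zero {δ t : ℝ} (hδ : 0 < δ) (ht : t ≤ δ) : Tst δ t = 0 :=
  Real.smoothTransition.zero_of_nonpos (div_nonpos_of_nonpos_of_nonneg (by linarith) hδ.le)

lemma Tfn_zero {δ s : ℝ} (hδ : 0 < δ) (hs : s ≤ δ) : Tfn δ s = 0 := by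
  unfold Tfn
  apply intervalIntegral.integral_zero_ae
  refine Eventually.of_forall fun t ht => Tst_zero hδ ?_
  have := ht.2
  rcases le_max_iff.1 this with h | h <;> linarith

lemma Tfn_nonneg {δ s : ℝ} (hδ : 0 < δ) (hs : 0 ≤ s) : 0 ≤ Tfn δ s :=
  intervalIntegral.integral_nonneg hs (fun t _ => Real.smoothTransition.nonneg _)

lemma Tfn_ge {δ s : ℝ} (hδ : 0 < δ) (hs : 2 * δ ≤ s) : s - 2 * δ ≤ Tfn δ s := by
  unfold Tfn
  have hc := (Tst_contDiff δ).continuous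
  rw [← intervalIntegral.integral_add_adjacent_intervals (hc.intervalIntegrable 0 (2*δ)) (hc.intervalIntegrable (2*δ) s)]
  have h1 : 0 ≤ ∫ t in (0:ℝ)..(2*δ), Tst δ t := intervalIntegral.integral_nonneg (by linarith) (fun t _ => Real.smoothTransition.nonneg _)
  have h2 : ∫ t in (2*δ)..s, Tst δ t = ∫ t in (2*δ)..s, (1:ℝ) := by
    apply intervalIntegral.integral_congr
    intro t ht
    rw [Set.uIcc_of_le hs] at ht
    apply Real.smoothTransition.one_of_one_le
    rw [le_div_iff₀ hδ]; linarith [ht.1]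
  rw [h2, intervalIntegral.integral_const]
  simp; exact h1

lemma Tfn_sq {δ s : ℝ} (hδ : 0 < δ) (hs : 0 ≤ s) (hs1 : s ≤ 1) : s ^ 2 - 4 * δ ≤ Tfn δ s ^ 2 := by
  rcases le_total (2 * δ) s with h | h
  · have := Tfn_ge hδ h
    have h2 : (s - 2 * δ)^2 ≤ Tfn δ s ^ 2 := pow_le_pow_left₀ (by linarith) this 2
    nlinarith
  · nlinarith [sq_nonneg (Tfn δ s)]

lemma bump_local {S : Set ℝ} (hS : IsOpen S) {g : ℝ → ℝ} (hg : Continuous g) (hfr : ∀ x ∈ frontier S, g x ≤ 0)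
    {δ : ℝ} (hδ : 0 < δ) (x : ℝ) (hx : x ∉ S) : S.indicator (fun x => Tfn δ (g x)) =ᶠ[𝓝 x] fun _ => 0 := by
  by_cases hxc : x ∈ closure S
  · have hfx : x ∈ frontier S := by rw [frontier, hS.interior_eq]; exact ⟨hxc, hx⟩
    have : ∀ᶠ y in 𝓝 x, g y < δ := hg.continuousAt.eventually_lt_const ((hfr x hfx).trans_lt hδ)
    filter_upwards [this] with y hy
    by_cases hyS : y ∈ S
    · rw [Set.indicator_of_mem hyS]; exact Tfn_zero hδ hy.le
    · rw [Set.indicator_of_notMem hyS]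
  · filter_upwards [isClosed_closure.isOpen_compl.mem_nhds hxc] with y hy
    rw [Set.indicator_of_notMem (fun h => hy (subset_closure h))]

lemma bump_in {S : Set ℝ} (hS : IsOpen S) (F : ℝ → ℝ) (x : ℝ) (hx : x ∈ S) : S.indicator F =ᶠ[𝓝 x] F := by
  filter_upwards [hS.mem_nhds hx] with y hy
  rw [Set.indicator_of_mem hy]

def Good (h : ℝ → ℝ) (D κ : ℝ) (S : Set ℝ) : Prop :=
  ∀ η > 0, ∃ φ : ℝ → ℝ, ContDiff ℝ (⊤ : ℕ∞) φ ∧ (∀ x ∉ S, φ x = 0) ∧ (∀ x ∉ S, deriv φ x = 0) ∧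
    (∫ x in Set.Ioo 0 D, deriv φ x ^ 2 * h x ≤ (κ ^ 2 + η) * ∫ x in Set.Ioo 0 D, φ x ^ 2 * h x) ∧
    0 < ∫ x in Set.Ioo 0 D, φ x ^ 2 * h x

lemma mul_h_int {D : ℝ} {h F : ℝ → ℝ} (hi : IntegrableOn h (Set.Ioo 0 D)) (hF : Continuous F) :
    IntegrableOn (fun x => F x * h x) (Set.Ioo 0 D) :=
  IntegrableOn.continuousOn_mul_of_subset hF.continuousOn hi isCompact_Icc measurableSet_Ioo Set.Ioo_subset_Icc_self

lemma good_of {D κ : ℝ} {S : Set ℝ} {g h : ℝ → ℝ} (hSo : IsOpen S) (hg : ContDiff ℝ (⊤ : ℕ∞) g)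
    (hfr : ∀ x ∈ frontier S, g x ≤ 0) (hg01 : ∀ x ∈ Set.Ioo 0 D ∩ S, 0 < g x ∧ g x ≤ 1)
    (hne : (Set.Ioo 0 D ∩ S).Nonempty) (hi : IntegrableOn h (Set.Ioo 0 D)) (hpos : ∀ x ∈ Set.Ioo 0 D, 0 < h x)
    (key : ∫ x in Set.Ioo 0 D ∩ S, deriv g x ^ 2 * h x ≤ κ ^ 2 * ∫ x in Set.Ioo 0 D ∩ S, g x ^ 2 * h x) :
    Good h D κ S := by
  intro η hη
  set I := Set.Ioo 0 D with hI
  have hgc := hg.continuous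
  have hg'c : Continuous (deriv g) := hg.continuous_deriv (by simp)
  set B := ∫ x in I ∩ S, g x ^ 2 * h x with hB
  have hIS : MeasurableSet (I ∩ S) := (isOpen_Ioo.inter hSo).measurableSet
  have hB0 : 0 < B := by
    rw [hB, setIntegral_pos_iff_support_of_nonneg_ae]
    · have : Function.support (fun x => g x ^ 2 * h x) ∩ (I ∩ S) = I ∩ S := by
        apply Set.inter_eq_self_of_subset_right
        intro x hx
        have h1 := (hg01 x hx).1
        have h2 := hpos x hx.1
        exact (by positivity : 0 < g x ^ 2 * h x).ne'
      rw [this]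
      exact (isOpen_Ioo.inter hSo).measure_pos volume hne
    · filter_upwards [ae_restrict_mem hIS] with x hx
      have h2 := hpos x hx.1
      show 0 ≤ g x ^ 2 * h x
      positivity
    · exact (mul_h_int hi (hgc.pow 2)).mono_set Set.inter_subset_left
  set H := ∫ x in I, h x with hH
  have hH0 : 0 ≤ H := setIntegral_nonneg measurableSet_Ioo fun x hx => (hpos x hx).le
  obtain ⟨δ, hδ, hδ2⟩ : ∃ δ > 0, κ ^ 2 * B ≤ (κ ^ 2 + η) * (B - 4 * δ * H) ∧ 0 < B - 4 * δ * H := by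
    refine ⟨η * B / (8 * (κ ^ 2 + η) * (H + 1)), by positivity, ?_⟩
    set δ := η * B / (8 * (κ ^ 2 + η) * (H + 1)) with hδ
    have e1 : (κ ^ 2 + η) * δ * (H + 1) = η * B / 8 := by rw [hδ]; field_simp
    have hδ0 : 0 < δ := by positivity
    have e2 : (κ ^ 2 + η) * δ * H ≤ η * B / 8 := by
      rw [← e1]; exact mul_le_mul_of_nonneg_left (by linarith) (by positivity)
    have e3 : κ ^ 2 * B ≤ (κ ^ 2 + η) * (B - 4 * δ * H) := by nlinarith
    refine ⟨e3, ?_⟩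
    have e4 : η * (δ * H) ≤ η * B / 8 := by
      have : 0 ≤ κ^2 * (δ * H) := by positivity
      nlinarith
    have e5 : δ * H ≤ B / 8 := by
      have : η * (δ * H) ≤ η * (B / 8) := by linarith
      exact le_of_mul_le_mul_left this hη
    linarith
  set φ := S.indicator (fun x => Tfn δ (g x)) with hφ
  have hTg : ContDiff ℝ (⊤ : ℕ∞) (fun x => Tfn δ (g x)) := (Tfn_contDiff δ).comp hg
  have hφs : ContDiff ℝ (⊤ : ℕ∞) φ := by
    rw [contDiff_iff_contDiffAt]
    intro x
    by_cases hx : x ∈ S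
    · exact hTg.contDiffAt.congr_of_eventuallyEq (bump_in hSo _ x hx)
    · exact contDiffAt_const.congr_of_eventuallyEq (bump_local hSo hgc hfr hδ x hx)
  have hd0 : ∀ x ∉ S, deriv φ x = 0 := fun x hx => by
    rw [(bump_local hSo hgc hfr hδ x hx).deriv_eq]; simp
  have hd1 : ∀ x ∈ S, deriv φ x = Tst δ (g x) * deriv g x := fun x hx => by
    rw [(bump_in hSo _ x hx).deriv_eq]
    exact ((Tfn_hasDeriv δ (g x)).comp x (hg.differentiable (by simp) x).hasDerivAt).deriv
  have hφc := hφs.continuous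
  have hφ'c : Continuous (deriv φ) := hφs.continuous_deriv (by simp)
  have b1 : ∫ x in I, deriv φ x ^ 2 * h x ≤ κ ^ 2 * B := by
    refine le_trans ?_ key
    rw [← setIntegral_indicator hSo.measurableSet]
    refine setIntegral_mono_on (mul_h_int hi (hφ'c.pow 2)) ?_ measurableSet_Ioo ?_
    · exact (mul_h_int hi (hg'c.pow 2)).indicator hSo.measurableSet
    · intro x hx
      have h2 := hpos x hx
      by_cases hxS : x ∈ S
      · rw [Set.indicator_of_mem hxS, hd1 x hxS]
        apply mul_le_mul_of_nonneg_right _ h2.le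
        rw [mul_pow]
        have h3 : Tst δ (g x) ^ 2 ≤ 1 := pow_le_one₀ (Real.smoothTransition.nonneg _) (Real.smoothTransition.le_one _)
        exact mul_le_of_le_one_left (sq_nonneg _) h3
      · rw [Set.indicator_of_notMem hxS, hd0 x hxS]; simp
  have b2 : B - 4 * δ * H ≤ ∫ x in I, φ x ^ 2 * h x := by
    have : B - 4 * δ * H = ∫ x in I, (S.indicator (fun x => g x ^ 2 * h x) x - 4 * δ * h x) := by
      rw [integral_sub, setIntegral_indicator hSo.measurableSet, integral_const_mul]
      · exact (mul_h_int hi (hgc.pow 2)).indicator hSo.measurableSet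
      · exact hi.const_mul _
    rw [this]
    refine setIntegral_mono_on ?_ (mul_h_int hi (hφc.pow 2)) measurableSet_Ioo ?_
    · exact ((mul_h_int hi (hgc.pow 2)).indicator hSo.measurableSet).sub (hi.const_mul _)
    · intro x hx
      have h2 := hpos x hx
      by_cases hxS : x ∈ S
      · have h01 := hg01 x ⟨hx, hxS⟩
        rw [Set.indicator_of_mem hxS, hφ, Set.indicator_of_mem hxS]
        have := mul_le_mul_of_nonneg_right (Tfn_sq hδ h01.1.le h01.2) h2.le
        linarith
      · rw [Set.indicator_of_notMem hxS]
        have : 0 ≤ φ x ^ 2 * h x := by positivity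
        have : 0 ≤ 4 * δ * h x := by positivity
        linarith
  refine ⟨φ, hφs, fun x hx => Set.indicator_of_notMem hx _, hd0, ?_, by linarith [hδ2.2]⟩
  calc ∫ x in I, deriv φ x ^ 2 * h x ≤ κ ^ 2 * B := b1
    _ ≤ (κ ^ 2 + η) * (B - 4 * δ * H) := hδ2.1
    _ ≤ _ := mul_le_mul_of_nonneg_left b2 (by positivity)

lemma concave_div_anti {D : ℝ} {h : ℝ → ℝ} (hc : ConcaveOn ℝ (Set.Ioo 0 D) h) (hpos : ∀ x ∈ Set.Ioo 0 D, 0 < h x) :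
    AntitoneOn (fun x => h x / x) (Set.Ioo 0 D) := by
  intro x hx y hy hxy
  rcases eq_or_lt_of_le hxy with rfl | hlt
  · exact le_rfl
  have hx0 := hx.1
  have hy0 := hy.1
  show h y / y ≤ h x / x
  rw [div_le_div_iff₀ hy0 hx0]
  have key : ∀ δ ∈ Set.Ioo 0 x, 0 ≤ (y - δ) * h x - (x - δ) * h y := by
    intro δ hδ
    have hyδ : 0 < y - δ := by linarith [hδ.2]
    have hδm : δ ∈ Set.Ioo 0 D := ⟨hδ.1, by linarith [hδ.2, hx.2]⟩
    have := hc.2 hδm hy (show 0 ≤ (y - x) / (y - δ) from div_nonneg (by linarith) hyδ.le)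
      (show 0 ≤ (x - δ) / (y - δ) from div_nonneg (by linarith [hδ.2]) hyδ.le) (by field_simp; ring)
    have e : ((y - x) / (y - δ)) • δ + ((x - δ) / (y - δ)) • y = x := by
      simp only [smul_eq_mul]; field_simp; ring
    rw [e] at this
    simp only [smul_eq_mul] at this
    have h3 : 0 ≤ (y - x) / (y - δ) * h δ := mul_nonneg (div_nonneg (by linarith) hyδ.le) (hpos δ hδm).le
    have h4 : (x - δ) / (y - δ) * h y ≤ h x := by linarith
    rw [div_mul_eq_mul_div, div_le_iff₀ hyδ] at h4
    linarith
  have hcont : Continuous fun δ : ℝ => (y - δ) * h x - (x - δ) * h y := by fun_prop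
  have ht : Tendsto (fun δ : ℝ => (y - δ) * h x - (x - δ) * h y) (𝓝[>] 0) (𝓝 ((y - 0) * h x - (x - 0) * h y)) :=
    (hcont.tendsto 0).mono_left nhdsWithin_le_nhds
  have := ge_of_tendsto ht (by
    filter_upwards [Ioo_mem_nhdsGT hx0] with δ hδ using key δ hδ)
  linarith

lemma J0_le_one {x : ℝ} (hx : 0 ≤ x) (hx1 : x < besselZero1 0) : J0 x ≤ 1 := by
  have hnn : ∀ y ∈ Set.Icc 0 x, 0 ≤ J0 y := fun y hy => (J0_pos_of_lt hy.1 (hy.2.trans_lt hx1)).le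
  have hd := J0'_nonpos hnn
  have hanti : AntitoneOn J0 (Set.Icc 0 x) := by
    apply antitoneOn_of_deriv_nonpos (convex_Icc 0 x) J0_contDiff.continuous.continuousOn
    · exact fun y _ => (J0_hasDerivAt y).differentiableAt.differentiableWithinAt
    · intro y hy
      rw [(J0_hasDerivAt y).deriv]
      exact hd y (interior_subset hy)
  have := hanti (Set.left_mem_Icc.2 hx) (Set.right_mem_Icc.2 hx) hx
  rwa [J0_zero] at this

lemma good_left {D κ : ℝ} {h : ℝ → ℝ} (hκ : 0 < κ) (hD : besselZero1 0 / κ ≤ D)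
    (hc : ConcaveOn ℝ (Set.Ioo 0 D) h) (hi : IntegrableOn h (Set.Ioo 0 D)) (hpos : ∀ x ∈ Set.Ioo 0 D, 0 < h x) :
    Good h D κ (Set.Iio (besselZero1 0 / κ)) := by
  have hj := bz_mem.1
  set a := besselZero1 0 / κ with ha
  have ha0 : 0 < a := by positivity
  have hset : Set.Ioo 0 D ∩ Set.Iio a = Set.Ioo 0 a := by
    ext x; simp only [Set.mem_inter_iff, Set.mem_Ioo, Set.mem_Iio]
    constructor
    · rintro ⟨⟨h1, h2⟩, h3⟩; exact ⟨h1, h3⟩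
    · rintro ⟨h1, h2⟩; exact ⟨⟨h1, h2.trans_le hD⟩, h2⟩
  have hsub : Set.Ioo 0 a ⊆ Set.Ioo 0 D := Set.Ioo_subset_Ioo_right hD
  have hder : ∀ x, deriv (fun x => J0 (κ * x)) x = κ * J0' (κ * x) := by
    intro x
    have h1 : HasDerivAt (fun x : ℝ => κ * x) κ x := by simpa using (hasDerivAt_id x).const_mul κ
    have := ((J0_hasDerivAt (κ * x)).comp x h1).deriv
    rw [mul_comm]; exact this
  apply good_of (g := fun x => J0 (κ * x)) isOpen_Iio (J0_contDiff.comp (by fun_prop))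
  · intro x hx
    rw [frontier_Iio] at hx
    obtain rfl : x = a := hx
    have : κ * a = besselZero1 0 := by rw [ha]; field_simp
    rw [this, bz_mem.2]
  · intro x hx
    rw [hset] at hx
    have h2 : κ * x < besselZero1 0 := by
      have := hx.2; rw [ha, lt_div_iff₀ hκ] at this; linarith
    have h1 : 0 ≤ κ * x := by have := hx.1; positivity
    exact ⟨J0_pos_of_lt h1 h2, J0_le_one h1 h2⟩
  · rw [hset]; exact Set.nonempty_Ioo.2 ha0
  · exact hi
  · exact hpos
  · rw [hset]
    simp_rw [hder]
    exact end_piece hκ (hi.mono_set hsub) (fun x hx => (hpos x (hsub hx)).le) ((concave_div_anti hc hpos).mono hsub)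

lemma good_mid {D κ m : ℝ} {h : ℝ → ℝ} (hκ : 0 < κ) (h1 : 0 ≤ m - π / (2 * κ)) (h2 : m + π / (2 * κ) ≤ D)
    (hc : ConcaveOn ℝ (Set.Ioo 0 D) h) (hi : IntegrableOn h (Set.Ioo 0 D)) (hpos : ∀ x ∈ Set.Ioo 0 D, 0 < h x) :
    Good h D κ (Set.Ioo (m - π / (2 * κ)) (m + π / (2 * κ))) := by
  have hr : 0 < π / (2 * κ) := by positivity
  have hsub : Set.Ioo (m - π / (2 * κ)) (m + π / (2 * κ)) ⊆ Set.Ioo 0 D := Set.Ioo_subset_Ioo h1 h2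
  have hset := Set.inter_eq_self_of_subset_right hsub
  have hder : ∀ x, deriv (fun x => cos (κ * (x - m))) x = κ * -sin (κ * (x - m)) := by
    intro x
    have h1 : HasDerivAt (fun x : ℝ => κ * (x - m)) κ x := by simpa using ((hasDerivAt_id x).sub_const m).const_mul κ
    have := ((hasDerivAt_cos (κ * (x - m))).comp x h1).deriv
    rw [mul_comm]; exact this
  have hkr : κ * (π / (2 * κ)) = π / 2 := by field_simp
  apply good_of (g := fun x => cos (κ * (x - m))) isOpen_Ioo (contDiff_cos.comp (by fun_prop))
  · intro x hx
    rw [frontier_Ioo (by linarith)] at hx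
    rcases hx with rfl | hx
    · have : κ * (m - π / (2 * κ) - m) = -(π / 2) := by rw [← hkr]; ring
      rw [this, cos_neg, cos_pi_div_two]
    · obtain rfl : x = _ := hx
      have : κ * (m + π / (2 * κ) - m) = π / 2 := by rw [← hkr]; ring
      rw [this, cos_pi_div_two]
  · intro x hx
    rw [hset] at hx
    refine ⟨cos_pos_of_mem_Ioo ⟨?_, ?_⟩, cos_le_one _⟩
    · rw [← hkr, ← mul_neg]; exact mul_lt_mul_of_pos_left (by linarith [hx.1]) hκ
    · rw [← hkr]; exact mul_lt_mul_of_pos_left (by linarith [hx.2]) hκ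
  · rw [hset]; exact Set.nonempty_Ioo.2 (by linarith)
  · exact hi
  · exact hpos
  · rw [hset]
    simp_rw [hder]
    exact mid_piece hκ (hi.mono_set hsub) (fun x hx => (hpos x (hsub hx)).le) (hc.subset hsub (convex_Ioo _ _))

lemma refl_int (F : ℝ → ℝ) (D α β : ℝ) : ∫ x in Set.Ioo α β, F x = ∫ x in Set.Ioo (D - β) (D - α), F (D - x) := by
  have := (Measure.measurePreserving_sub_left volume D).setIntegral_preimage_emb
    (MeasurableEquiv.subLeft D).measurableEmbedding F (Set.Ioo α β)
  rw [← this]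
  congr 2
  ext x; simp only [Set.mem_preimage, Set.mem_Ioo]
  constructor <;> rintro ⟨h1, h2⟩ <;> constructor <;> linarith

lemma good_right {D κ : ℝ} {h : ℝ → ℝ} (hκ : 0 < κ) (hD : besselZero1 0 / κ ≤ D)
    (hc : ConcaveOn ℝ (Set.Ioo 0 D) h) (hi : IntegrableOn h (Set.Ioo 0 D)) (hpos : ∀ x ∈ Set.Ioo 0 D, 0 < h x) :
    Good h D κ (Set.Ioi (D - besselZero1 0 / κ)) := by
  have hrm : ∀ x ∈ Set.Ioo 0 D, D - x ∈ Set.Ioo 0 D := fun x hx => ⟨by linarith [hx.2], by linarith [hx.1]⟩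
  have hc' : ConcaveOn ℝ (Set.Ioo 0 D) (fun x => h (D - x)) := by
    refine ⟨convex_Ioo _ _, fun x hx y hy a b ha hb hab => ?_⟩
    have := hc.2 (hrm x hx) (hrm y hy) ha hb hab
    have e : a • (D - x) + b • (D - y) = D - (a • x + b • y) := by
      simp only [smul_eq_mul]
      obtain rfl : a = 1 - b := by linarith
      ring
    rwa [e] at this
  have hi' : IntegrableOn (fun x => h (D - x)) (Set.Ioo 0 D) := by
    have := (Measure.measurePreserving_sub_left volume D).integrableOn_comp_preimage
      (MeasurableEquiv.subLeft D).measurableEmbedding (f := h) (s := Set.Ioo 0 D)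
    have e : (fun x => D - x) ⁻¹' Set.Ioo 0 D = Set.Ioo 0 D := by
      ext x; simp only [Set.mem_preimage, Set.mem_Ioo]
      constructor <;> rintro ⟨h1, h2⟩ <;> constructor <;> linarith
    rw [e] at this
    exact this.2 hi
  have hG := good_left hκ hD hc' hi' (fun x hx => hpos _ (hrm x hx))
  intro η hη
  obtain ⟨φ, p1, p2, p3, p4, p5⟩ := hG η hη
  have hdd : ∀ x, deriv (fun x => φ (D - x)) x = - deriv φ (D - x) := fun x => deriv_comp_const_sub _ _ _
  have r1 : ∀ F : ℝ → ℝ, ∫ x in Set.Ioo 0 D, F (D - x) * h x = ∫ x in Set.Ioo 0 D, F x * h (D - x) := by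
    intro F
    rw [refl_int _ D 0 D]
    simp
  refine ⟨fun x => φ (D - x), p1.comp (by fun_prop), ?_, ?_, ?_, ?_⟩
  · intro x hx; apply p2; simp at hx ⊢; linarith
  · intro x hx; rw [hdd, p3, neg_zero]; simp at hx ⊢; linarith
  · simp_rw [hdd, neg_sq]
    rw [r1 (fun x => deriv φ x ^ 2), r1 (fun x => φ x ^ 2)]
    exact p4
  · rw [r1 (fun x => φ x ^ 2)]; exact p5

lemma conc_int {D M : ℝ} {h : ℝ → ℝ} (hc : ConcaveOn ℝ (Set.Ioo 0 D) h) (hpos : ∀ x ∈ Set.Ioo 0 D, 0 < h x)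
    (hM : ∀ x, h x ≤ M) : IntegrableOn h (Set.Ioo 0 D) := by
  have hcont := hc.continuousOn isOpen_Ioo
  have hi : Integrable (fun _ : ℝ => M) (volume.restrict (Set.Ioo 0 D)) := integrable_const M
  refine hi.mono' (hcont.aestronglyMeasurable measurableSet_Ioo) ?_
  filter_upwards [ae_restrict_mem measurableSet_Ioo] with x hx
  rw [Real.norm_of_nonneg (hpos x hx).le]; exact hM x

lemma sets_exist {k : ℕ} (hk : 1 ≤ k) {D κ : ℝ} (hκ : 0 < κ) (hD : κ * D = 2 * besselZero1 0 + ((k:ℝ) - 1) * π) {h : ℝ → ℝ}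
    (hc : ConcaveOn ℝ (Set.Ioo 0 D) h) (hi : IntegrableOn h (Set.Ioo 0 D)) (hpos : ∀ x ∈ Set.Ioo 0 D, 0 < h x) :
    ∃ S : Fin (k+1) → Set ℝ, (∀ i, Good h D κ (S i)) ∧ (∀ i j, i ≠ j → Disjoint (S i) (S j)) := by
  have hj := bz_mem.1
  set a := besselZero1 0 / κ with ha
  have ha0 : 0 < a := by positivity
  set w := π / κ with hw
  have hw0 : 0 < w := by positivity
  have hw2 : π / (2 * κ) = w / 2 := by rw [hw]; field_simp
  have hDe : D = 2 * a + ((k:ℝ) - 1) * w := by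
    rw [ha, hw]; field_simp; linarith
  have hk1 : (1:ℝ) ≤ k := by exact_mod_cast hk
  have haD : a ≤ D := by rw [hDe]; nlinarith
  let S : Fin (k+1) → Set ℝ := fun i => if i.val = 0 then Set.Iio a else if i.val = k then Set.Ioi (D - a) else
    Set.Ioo ((a + ((i.val:ℝ) - 1/2) * w) - π / (2 * κ)) ((a + ((i.val:ℝ) - 1/2) * w) + π / (2 * κ))
  refine ⟨S, ?_, ?_⟩
  · intro i
    simp only [S]
    split_ifs with h0 h1
    · exact good_left hκ haD hc hi hpos
    · exact good_right hκ haD hc hi hpos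
    · have hi1 : (1:ℝ) ≤ i.val := by exact_mod_cast Nat.one_le_iff_ne_zero.2 h0
      have hik : (i.val:ℝ) ≤ (k:ℝ) - 1 := by
        have : i.val + 1 ≤ k := by have := i.2; omega
        have : ((i.val:ℝ) + 1) ≤ k := by exact_mod_cast this
        linarith
      apply good_mid hκ _ _ hc hi hpos
      · rw [hw2]; nlinarith
      · rw [hw2, hDe]; nlinarith
  · have hup : ∀ i : Fin (k+1), i.val ≠ k → ∀ x ∈ S i, x ≤ a + (i.val:ℝ) * w := by
      intro i hik x hx
      simp only [S] at hx
      split_ifs at hx with h0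
      · rw [h0]; have : x < a := hx; simp; exact this.le
      · rw [hw2] at hx; linarith [hx.2]
    have hlow : ∀ i : Fin (k+1), i.val ≠ 0 → ∀ x ∈ S i, a + ((i.val:ℝ) - 1) * w < x := by
      intro i hi0 x hx
      simp only [S] at hx
      split_ifs at hx with h0 h1
      · exact absurd h0 hi0
      · have : D - a < x := hx
        rw [h1]; rw [hDe] at this; linarith
      · rw [hw2] at hx; linarith [hx.1]
    have hlt : ∀ i j : Fin (k+1), i.val < j.val → Disjoint (S i) (S j) := by
      intro i j hij
      rw [Set.disjoint_left]
      intro x hx1 hx2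
      have q1 := hup i (by have := j.2; omega) x hx1
      have q2 := hlow j (by omega) x hx2
      have : ((i.val:ℝ) + 1) ≤ j.val := by exact_mod_cast hij
      nlinarith
    intro i j hij
    rcases lt_or_gt_of_ne (fun h => hij (Fin.ext h) : i.val ≠ j.val) with h | h
    · exact hlt i j h
    · exact (hlt j i h).symm

lemma sum_sq_disj {n : ℕ} (c a : Fin n → ℝ) (h : ∀ i j, i ≠ j → a i * a j = 0) : (∑ i, c i * a i) ^ 2 = ∑ i, c i ^ 2 * a i ^ 2 := by
  rw [sq, Finset.sum_mul_sum]
  refine Finset.sum_congr rfl fun i _ => ?_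
  rw [Finset.sum_eq_single i]
  · ring
  · intro j _ hj
    have := h i j hj.symm
    linear_combination (c i * c j) * this
  · simp

theorem kroger_upper {Ω : Set (Euc 2)} (hΩ : IsConvexDomain Ω) {k : ℕ} (hk : 1 ≤ k) {κ : ℝ} (hκ : 0 < κ)
    (hD : κ * Metric.diam Ω = 2 * besselZero1 0 + ((k:ℝ) - 1) * π) {η : ℝ} (hη : 0 < η) :
    ∃ V : Submodule ℝ (Euc 2 → ℝ), (∀ u ∈ V, ContDiff ℝ (⊤ : ℕ∞) u) ∧
      Module.finrank ℝ (V.map (LinearMap.funLeft ℝ ℝ ((↑) : Ω → Euc 2))) = k + 1 ∧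
      ∀ u ∈ V, 0 < ∫ x in Ω, (u x) ^ 2 → rayleigh Ω u ≤ κ ^ 2 + η := by
  obtain ⟨p, e, h, M, he, hconc, hpos, hM, hfub, hcoord, hcl, hth⟩ := exists_frame hΩ
  obtain ⟨hn, ho, hb, hc⟩ := hΩ
  set D := Metric.diam Ω
  have hi := conc_int hconc hpos hM
  obtain ⟨S, hS, hdis⟩ := sets_exist hk hκ hD hconc hi hpos
  choose φ p1 p2 p3 p4 p5 using fun i => hS i η hη
  have hφc : ∀ i, Continuous (φ i) := fun i => (p1 i).continuous
  have hφ'c : ∀ i, Continuous (deriv (φ i)) := fun i => (p1 i).continuous_deriv (by simp)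
  let X : Euc 2 → ℝ := fun z => inner ℝ e (z - p)
  have hX : ContDiff ℝ (⊤ : ℕ∞) X := contDiff_const.inner ℝ (contDiff_id.sub contDiff_const)
  have hXd : ∀ z, HasFDerivAt X (innerSL ℝ e) z := by
    intro z
    have := ((innerSL ℝ e).hasFDerivAt (x := z - p)).comp z ((hasFDerivAt_id z).sub_const p)
    rw [ContinuousLinearMap.comp_id] at this
    exact this
  let U : Fin (k+1) → Euc 2 → ℝ := fun i z => φ i (X z)
  have hprod : ∀ x i j, i ≠ j → φ i x * φ j x = 0 := by
    intro x i j hij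
    by_cases hx : x ∈ S i
    · have : x ∉ S j := fun h' => Set.disjoint_left.1 (hdis i j hij) hx h'
      rw [p2 j x this, mul_zero]
    · rw [p2 i x hx, zero_mul]
  have hprod' : ∀ x i j, i ≠ j → deriv (φ i) x * deriv (φ j) x = 0 := by
    intro x i j hij
    by_cases hx : x ∈ S i
    · have : x ∉ S j := fun h' => Set.disjoint_left.1 (hdis i j hij) hx h'
      rw [p3 j x this, mul_zero]
    · rw [p3 i x hx, zero_mul]
  have hL2 : ∀ c : Fin (k+1) → ℝ, ∫ z in Ω, (∑ i, c i * U i z) ^ 2 = ∑ i, c i ^ 2 * ∫ x in Set.Ioo 0 D, φ i x ^ 2 * h x := by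
    intro c
    have e1 : ∀ z, (∑ i, c i * U i z) ^ 2 = ∑ i, c i ^ 2 * φ i (X z) ^ 2 := fun z =>
      sum_sq_disj c (fun i => φ i (X z)) (hprod (X z))
    simp_rw [e1]
    have hXc := hX.continuous
    rw [integral_finsetSum _ (fun i _ => int_on hb (by have := hφc i; fun_prop))]
    refine Finset.sum_congr rfl fun i _ => ?_
    rw [integral_const_mul]
    congr 1
    exact hfub (fun x => φ i x ^ 2) ((hφc i).pow 2)
  have hfd : ∀ (c : Fin (k+1) → ℝ) z, ‖fderiv ℝ (fun z => ∑ i, c i * U i z) z‖ ^ 2 = ∑ i, c i ^ 2 * deriv (φ i) (X z) ^ 2 := by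
    intro c z
    have hd : HasDerivAt (fun x => ∑ i, c i * φ i x) (∑ i, c i * deriv (φ i) (X z)) (X z) :=
      HasDerivAt.fun_sum fun i _ => (((p1 i).differentiable (by simp) (X z)).hasDerivAt.const_mul (c i))
    have h1 : HasFDerivAt (fun z => ∑ i, c i * U i z) ((∑ i, c i * deriv (φ i) (X z)) • innerSL ℝ e) z :=
      hd.comp_hasFDerivAt z (hXd z)
    rw [h1.fderiv, norm_smul, innerSL_apply_norm, he, mul_one, Real.norm_eq_abs, sq_abs]
    exact sum_sq_disj c (fun i => deriv (φ i) (X z)) (hprod' (X z))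
  have hEn : ∀ c : Fin (k+1) → ℝ, ∫ z in Ω, ‖fderiv ℝ (fun z => ∑ i, c i * U i z) z‖ ^ 2 = ∑ i, c i ^ 2 * ∫ x in Set.Ioo 0 D, deriv (φ i) x ^ 2 * h x := by
    intro c
    simp_rw [hfd]
    have hXc := hX.continuous
    rw [integral_finsetSum _ (fun i _ => int_on hb (by have := hφ'c i; fun_prop))]
    refine Finset.sum_congr rfl fun i _ => ?_
    rw [integral_const_mul]
    congr 1
    exact hfub (fun x => deriv (φ i) x ^ 2) ((hφ'c i).pow 2)
  have hUs : ∀ i, ContDiff ℝ (⊤ : ℕ∞) (U i) := fun i => (p1 i).comp hX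
  have hrep : ∀ u ∈ Submodule.span ℝ (Set.range U), ∃ c : Fin (k+1) → ℝ, u = fun z => ∑ i, c i * U i z := by
    intro u hu
    obtain ⟨c, hc⟩ := (Submodule.mem_span_range_iff_exists_fun ℝ).1 hu
    refine ⟨c, ?_⟩
    rw [← hc]; funext z; simp
  refine ⟨Submodule.span ℝ (Set.range U), ?_, ?_, ?_⟩
  · intro u hu
    obtain ⟨c, rfl⟩ := hrep u hu
    exact ContDiff.sum fun i _ => contDiff_const.mul (hUs i)
  · rw [Submodule.map_span, ← Set.range_comp]
    rw [finrank_span_eq_card, Fintype.card_fin]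
    rw [Fintype.linearIndependent_iff]
    intro c hc0 i
    have hz : ∀ z ∈ Ω, ∑ i, c i * U i z = 0 := by
      intro z hz
      have := congrFun hc0 ⟨z, hz⟩
      rw [Finset.sum_apply] at this
      simpa [LinearMap.funLeft_apply] using this
    have h1 : ∫ z in Ω, (∑ i, c i * U i z) ^ 2 = 0 := by
      rw [setIntegral_congr_fun ho.measurableSet (g := fun _ => (0:ℝ)) (fun z hzz => by simp only; rw [hz z hzz]; simp)]
      simp
    rw [hL2, Finset.sum_eq_zero_iff_of_nonneg (fun i _ => mul_nonneg (sq_nonneg _) (p5 i).le)] at h1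
    have := h1 i (Finset.mem_univ i)
    rcases mul_eq_zero.1 this with h2 | h2
    · exact pow_eq_zero_iff (two_ne_zero) |>.1 h2
    · exact absurd h2 (p5 i).ne'
  · intro u hu hup
    obtain ⟨c, rfl⟩ := hrep u hu
    unfold rayleigh
    rw [div_le_iff₀ hup, hEn, hL2, Finset.mul_sum]
    refine Finset.sum_le_sum fun i _ => ?_
    have := mul_le_mul_of_nonneg_left (p4 i) (sq_nonneg (c i))
    linarith

lemma kappa_pos {k : ℕ} (hk : 1 ≤ k) : 0 < 2 * besselZero1 0 + ((k:ℝ) - 1) * π := by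
  have hj := bz_mem.1
  have hk1 : (1:ℝ) ≤ k := by exact_mod_cast hk
  have := mul_nonneg (sub_nonneg.2 hk1) pi_pos.le
  linarith

lemma rayleigh_nonneg (Ω : Set (Euc 2)) (u : Euc 2 → ℝ) : 0 ≤ rayleigh Ω u :=
  div_nonneg (integral_nonneg fun _ => sq_nonneg _) (integral_nonneg fun _ => sq_nonneg _)

theorem eig_bounds {Ω : Set (Euc 2)} (hΩ : IsConvexDomain Ω) {k : ℕ} (hk : 1 ≤ k) :
    (π / Metric.diam Ω) ^ 2 ≤ neumannEigenvalue k Ω ∧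
    neumannEigenvalue k Ω ≤ ((2 * besselZero1 0 + ((k:ℝ) - 1) * π) / Metric.diam Ω) ^ 2 := by
  have hD := diam_pos' hΩ
  have hA := kappa_pos hk
  set κ := (2 * besselZero1 0 + ((k:ℝ) - 1) * π) / Metric.diam Ω with hκ
  have hκ0 : 0 < κ := by positivity
  have hκD : κ * Metric.diam Ω = 2 * besselZero1 0 + ((k:ℝ) - 1) * π := div_mul_cancel₀ _ hD.ne'
  constructor
  · apply le_csInf
    · obtain ⟨V, h1, h2, h3⟩ := kroger_upper hΩ hk hκ0 hκD one_pos
      exact ⟨_, V, h1, h2, rfl⟩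
    · rintro t ⟨V, h1, h2, rfl⟩
      exact sup_lower hΩ hk h1 h2
  · apply le_of_forall_pos_le_add
    intro η hη
    obtain ⟨V, h1, h2, h3⟩ := kroger_upper hΩ hk hκ0 hκD hη
    refine le_trans (b := sSup { r : ℝ | ∃ u ∈ V, (0 < ∫ x in Ω, (u x) ^ 2) ∧ r = rayleigh Ω u }) (csInf_le ?_ ⟨V, h1, h2, rfl⟩) ?_
    · refine ⟨0, ?_⟩
      rintro t ⟨V, _, _, rfl⟩
      apply Real.sSup_nonneg
      rintro r ⟨u, _, _, rfl⟩
      exact rayleigh_nonneg _ _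
    · apply Real.sSup_le
      · rintro r ⟨u, hu, hup, rfl⟩
        exact h3 u hu hup
      · positivity

lemma ratio_main {k : ℕ} (hk : 1 ≤ k) {Ω₁ Ω₂ : Set (Euc 2)}
    (h₁ : IsConvexDomain Ω₁) (h₂ : IsConvexDomain Ω₂) (hsub : Ω₁ ⊆ Ω₂) :
    π ^ 2 / (2 * besselZero1 0 + ((k : ℝ) - 1) * π) ^ 2 * neumannEigenvalue k Ω₂ ≤ neumannEigenvalue k Ω₁ := by
  have hA := kappa_pos hk
  have hD1 := diam_pos' h₁
  have hD2 := diam_pos' h₂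
  have hle : Metric.diam Ω₁ ≤ Metric.diam Ω₂ := Metric.diam_mono hsub h₂.2.2.1
  set A := 2 * besselZero1 0 + ((k : ℝ) - 1) * π
  calc π ^ 2 / A ^ 2 * neumannEigenvalue k Ω₂ ≤ π ^ 2 / A ^ 2 * (A / Metric.diam Ω₂) ^ 2 :=
        mul_le_mul_of_nonneg_left (eig_bounds h₂ hk).2 (by positivity)
    _ = (π / Metric.diam Ω₂) ^ 2 := by field_simp
    _ ≤ (π / Metric.diam Ω₁) ^ 2 := by
        apply pow_le_pow_left₀ (by positivity)
        exact div_le_div_of_nonneg_left pi_pos.le hD1 hle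
    _ ≤ _ := (eig_bounds h₁ hk).1

/-- in dimension 2, `μ_k(Ω₁) ≥ (π²/(2j_{0,1} + (k-1)π)²) μ_k(Ω₂)` for nested
bounded convex domains; in particular `α_{k,2} ≥ π²/(2j_{0,1} + (k-1)π)²`. -/
theorem lower_bound_dim_two
    (k : ℕ) (hk : 1 ≤ k) (Ω₁ Ω₂ : Set (Euc 2))
    (h₁ : IsConvexDomain Ω₁) (h₂ : IsConvexDomain Ω₂) (hsub : Ω₁ ⊆ Ω₂) :
    neumannEigenvalue k Ω₁ ≥
      Real.pi ^ 2 / (2 * besselZero1 0 + ((k : ℝ) - 1) * Real.pi) ^ 2 *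
        neumannEigenvalue k Ω₂ ∧
    alphaConst k 2 ≥ Real.pi ^ 2 / (2 * besselZero1 0 + ((k : ℝ) - 1) * Real.pi) ^ 2 := by
  refine ⟨ratio_main hk h₁ h₂ hsub, ?_⟩
  apply le_csInf
  · exact ⟨_, Ω₁, Ω₂, h₁, h₂, hsub, rfl⟩
  · rintro r ⟨A, B, hA, hB, hAB, rfl⟩
    have hD := diam_pos' hB
    have hpos : 0 < neumannEigenvalue k B := lt_of_lt_of_le (by positivity) (eig_bounds hB hk).1
    rw [le_div_iff₀ hpos]
    exact ratio_main hk hA hB hAB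

end
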